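/- arXiv:2412.18336 — 2 statements merged into one kernel-verified Lean document; each statement's English description precedes it below -/
import Mathlib

section
/- For every η > 0 there exists n₀ ∈ ℕ such that for every n ≥ n₀ the following holds: if G is an n-vertex digraph with minimum total degree δ(G) ≥ (8/5 + η)n, then G contains the square of a Hamilton cycle. -/
namespace Paper

/-- `G` is a digraph: a loopless directed graph (edges in both directions allowed). -/
def IsDigraph {n : ℕ} (G : Fin n → Fin n → Prop) : Prop := ∀ v, ¬ G v v

/-- `G` is an oriented graph: no loops and at most one directed edge per pair. -/
def IsOriented {n : ℕ} (G : Fin n → Fin n → Prop) : Prop := ∀ u v, G u v → ¬ G v u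

/-- Out-degree of `v` in `G`. -/
noncomputable def outDeg {n : ℕ} (G : Fin n → Fin n → Prop) (v : Fin n) : ℕ :=
  {w | G v w}.ncard

/-- In-degree of `v` in `G`. -/
noncomputable def inDeg {n : ℕ} (G : Fin n → Fin n → Prop) (v : Fin n) : ℕ :=
  {w | G w v}.ncard

/-- `G` contains the `k`-th power of a Hamilton cycle: a cyclic ordering `f` of all the
vertices such that each vertex sends an edge to the next `k` vertices (indices mod `n`). -/
def HasPowHamCycle {n : ℕ} (k : ℕ) (G : Fin n → Fin n → Prop) : Prop :=
  ∃ f : Fin n ≃ Fin n, ∀ (i : Fin n) (j : ℕ), 1 ≤ j → j ≤ k →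
    G (f i) (f ⟨((i : ℕ) + j) % n, Nat.mod_lt _ (Nat.lt_of_le_of_lt (Nat.zero_le _) i.isLt)⟩)

/-- `P` is a `k`-path in `G` (the `k`-th power of a directed path): a list of distinct
vertices in which every vertex sends an edge to each of the next `k` vertices. -/
def IsKPath {n : ℕ} (k : ℕ) (G : Fin n → Fin n → Prop) (P : List (Fin n)) : Prop :=
  P.Nodup ∧ ∀ i j : Fin P.length, (i : ℕ) < (j : ℕ) → (j : ℕ) ≤ (i : ℕ) + k →
    G (P.get i) (P.get j)

section SquarePaths

variable {V : Type*} {G : V → V → Prop}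

/-- A list of vertices (not necessarily distinct) in which every vertex sends an edge to each of
the next two. -/
def IsSqPath (G : V → V → Prop) : List V → Prop
  | a :: b :: c :: l => G a b ∧ G a c ∧ IsSqPath G (b :: c :: l)
  | [a, b] => G a b
  | _ => True

theorem isSqPath_append_iff (A B : List V) (x y : V) :
    IsSqPath G (A ++ x :: y :: B) ↔ IsSqPath G (A ++ [x, y]) ∧ IsSqPath G (x :: y :: B) := by
  induction A with
  | nil => cases B <;> simp [IsSqPath]
  | cons a A ih =>
    rcases A with _ | ⟨b, _ | ⟨c, A⟩⟩
    · simp [IsSqPath, and_assoc]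
      cases B <;> simp [IsSqPath]; tauto
    · simp [IsSqPath] at ih ⊢; tauto
    · simp [IsSqPath] at ih ⊢; tauto

theorem IsSqPath.adj_getElem {l : List V} (h : IsSqPath G l) (i j : ℕ) (hij : i < j)
    (hj : j ≤ i + 2) (hl : j < l.length) : G l[i] l[j] := by
  induction l generalizing i j with
  | nil => simp at hl
  | cons a l ih =>
    rcases i with _ | i
    · rcases l with _ | ⟨b, _ | ⟨c, l⟩⟩
      · simp at hl; omega
      · simp at hl
        obtain rfl : j = 1 := by omega
        simpa [IsSqPath] using h
      · simp only [IsSqPath] at h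
        obtain rfl | rfl : j = 1 ∨ j = 2 := by omega
        · simpa using h.1
        · simpa using h.2.1
    · obtain ⟨j, rfl⟩ : ∃ j', j = j' + 1 := ⟨j - 1, by omega⟩
      simp only [List.getElem_cons_succ]
      refine ih ?_ i j (by omega) (by omega) (by simpa using hl)
      rcases l with _ | ⟨b, _ | ⟨c, l⟩⟩
      · simp [IsSqPath]
      · simp [IsSqPath]
      · exact h.2.2

end SquarePaths

open scoped Classical in
/-- The number of vertices of `S` which are not out-neighbours of `v`. -/
noncomputable def outMissing {V : Type*} (G : V → V → Prop) (v : V) (S : Finset V) : ℕ :=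
  (S.filter fun w => ¬ G v w).card

open scoped Classical in
/-- The number of vertices of `S` which are not in-neighbours of `v`. -/
noncomputable def inMissing {V : Type*} (G : V → V → Prop) (v : V) (S : Finset V) : ℕ :=
  (S.filter fun w => ¬ G w v).card

section Missing

variable {V : Type*} {G : V → V → Prop}

theorem card_le_outMissing {v : V} {A S : Finset V} (hA : A ⊆ S) (h : ∀ w ∈ A, ¬ G v w) :
    A.card ≤ outMissing G v S := by
  classical
  exact Finset.card_le_card fun w hw => Finset.mem_filter.2 ⟨hA hw, h w hw⟩

theorem card_le_inMissing {v : V} {A S : Finset V} (hA : A ⊆ S) (h : ∀ w ∈ A, ¬ G w v) :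
    A.card ≤ inMissing G v S := by
  classical
  exact Finset.card_le_card fun w hw => Finset.mem_filter.2 ⟨hA hw, h w hw⟩

theorem outMissing_mono (v : V) {S T : Finset V} (h : S ⊆ T) :
    outMissing G v S ≤ outMissing G v T := by
  classical
  exact Finset.card_le_card (Finset.filter_subset_filter _ h)

theorem inMissing_mono (v : V) {S T : Finset V} (h : S ⊆ T) :
    inMissing G v S ≤ inMissing G v T := by
  classical
  exact Finset.card_le_card (Finset.filter_subset_filter _ h)

theorem inMissing_union_of_disjoint [DecidableEq V] (v : V) {S T : Finset V}
    (h : Disjoint S T) : inMissing G v (S ∪ T) = inMissing G v S + inMissing G v T := by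
  classical
  unfold inMissing
  rw [Finset.filter_union, Finset.card_union_of_disjoint (Finset.disjoint_filter_filter h)]

end Missing

section Insertion

variable {V : Type*} {G : V → V → Prop}

open scoped Classical in
theorem length_le_of_forall_not_window (u : V) (B : List V) (p q r : V)
    (h : ∀ A a b c d C, p :: q :: r :: B = A ++ a :: b :: c :: d :: C →
      ¬ (G a u ∧ G b u ∧ G u c ∧ G u d)) :
    B.length ≤ 2 * B.countP (fun w => ¬ G w u) + 2 * B.countP (fun w => ¬ G u w)
      + (if G p u then 0 else 1) + 2 * (if G q u then 0 else 1)
      + 2 * (if G r u then 0 else 1) + (if G u r then 0 else 1) := by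
  induction B generalizing p q r with
  | nil => simp
  | cons s B ih =>
    have h1 := ih q r s fun A a b c d C hA => h (p :: A) a b c d C (by simp [hA])
    have h2 := h [] p q r s B rfl
    simp only [List.length_cons, List.countP_cons]
    by_cases hp : G p u <;> by_cases hq : G q u <;> by_cases hr : G u r <;>
      by_cases hs : G u s <;> by_cases hr' : G r u <;> by_cases hs' : G s u <;>
      simp only [hp, hq, hr, hs, hr', hs', if_true, if_false, not_true_eq_false, not_false_eq_true,
        decide_true, decide_false, and_self, Bool.false_eq_true] at h1 h2 ⊢ <;> omega

theorem exists_insert [DecidableEq V] {l T : List V} {u : V} (hl : l.Nodup)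
    (hp : IsSqPath G (l ++ T))
    (h : 2 * (outMissing G u l.toFinset + inMissing G u l.toFinset) + 3 < l.length) :
    ∃ l' : List V, l'.Perm (u :: l) ∧ IsSqPath G (l' ++ T) ∧ l'.take 2 = l.take 2 := by
  classical
  obtain ⟨A, a, b, c, d, C, rfl, ha, hb, hc, hd⟩ : ∃ A a b c d C, l = A ++ a :: b :: c :: d :: C ∧
      G a u ∧ G b u ∧ G u c ∧ G u d := by
    by_contra! hcon
    have hcount : ∀ (p : V → Prop) [DecidablePred p],
        l.countP (fun w => p w) = (l.toFinset.filter p).card := by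
      intro p _
      rw [List.countP_eq_length_filter, ← List.toFinset_card_of_nodup (hl.filter _),
        List.toFinset_filter]
      simp
    rcases l with _ | ⟨p, _ | ⟨q, _ | ⟨r, B⟩⟩⟩
    · simp at h
    · simp at h
    · simp at h
    have h1 := length_le_of_forall_not_window (G := G) u B p q r
      fun A a b c d C hA hG => hcon A a b c d C hA hG.1 hG.2.1 hG.2.2.1 hG.2.2.2
    have h2 : (p :: q :: r :: B).countP (fun w => ¬ G w u)
        = inMissing G u (p :: q :: r :: B).toFinset := by
      rw [hcount fun w => ¬ G w u, inMissing]
    have h3 : (p :: q :: r :: B).countP (fun w => ¬ G u w)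
        = outMissing G u (p :: q :: r :: B).toFinset := by
      rw [hcount fun w => ¬ G u w, outMissing]
    rw [← h2, ← h3] at h
    simp only [List.length_cons, List.countP_cons] at h
    by_cases hp' : G p u <;> by_cases hq : G q u <;> by_cases hr : G u r <;>
      by_cases hr' : G r u <;>
      simp only [hp', hq, hr, hr', if_true, if_false, not_true_eq_false, not_false_eq_true,
        decide_true, decide_false, Bool.false_eq_true] at h1 h <;> omega
  refine ⟨A ++ a :: b :: u :: c :: d :: C, ?_, ?_, ?_⟩
  · have := List.perm_middle (a := u) (l₁ := A ++ [a, b]) (l₂ := c :: d :: C)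
    simpa using this
  · simp only [List.append_assoc, List.cons_append] at hp ⊢
    rw [isSqPath_append_iff] at hp ⊢
    refine ⟨hp.1, ?_⟩
    have := hp.2
    simp only [IsSqPath] at this ⊢
    tauto
  · rcases A with _ | ⟨x, _ | ⟨y, A⟩⟩ <;> simp

theorem exists_saturated [DecidableEq V] [Fintype V] (Z : Finset V) {T : List V} (l : List V)
    (hl : l.Nodup) (hp : IsSqPath G (l ++ T)) :
    ∃ l' : List V, l'.Nodup ∧ IsSqPath G (l' ++ T) ∧ l'.take 2 = l.take 2 ∧
      l'.toFinset \ Z = l.toFinset \ Z ∧ l.length ≤ l'.length ∧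
      ∀ u ∈ Z, u ∉ l' →
        l'.length ≤ 2 * (outMissing G u l'.toFinset + inMissing G u l'.toFinset) + 3 := by
  induction hm : Fintype.card V - l.length using Nat.strong_induction_on generalizing l with
  | _ m ih =>
    by_cases hcon : ∀ u ∈ Z, u ∉ l →
        l.length ≤ 2 * (outMissing G u l.toFinset + inMissing G u l.toFinset) + 3
    · exact ⟨l, hl, hp, rfl, rfl, le_rfl, hcon⟩
    push Not at hcon
    obtain ⟨u, huZ, hul, hu⟩ := hcon
    obtain ⟨l₁, hperm, hp₁, ht⟩ := exists_insert hl hp hu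
    have hnd : l₁.Nodup := hperm.nodup_iff.2 (List.nodup_cons.2 ⟨hul, hl⟩)
    have hlen : l₁.length = l.length + 1 := by simpa using hperm.length_eq
    have hle : l₁.length ≤ Fintype.card V := hnd.length_le_card
    obtain ⟨l', h1, h2, h3, h4, h5, h6⟩ := ih (Fintype.card V - l₁.length) (by omega) l₁ hnd hp₁ rfl
    refine ⟨l', h1, h2, h3.trans ht, h4.trans ?_, by omega, h6⟩
    ext w
    simp only [Finset.mem_sdiff, List.mem_toFinset, hperm.mem_iff, List.mem_cons]
    constructor
    · rintro ⟨rfl | h, h'⟩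
      · exact absurd huZ h'
      · exact ⟨h, h'⟩
    · exact fun h => ⟨Or.inr h.1, h.2⟩

end Insertion

section Connecting

variable {V : Type*} {G : V → V → Prop}

/-- If weights split the pairs of vertices into light and heavy ones, and edges of both kinds
exist, then some transitive triangle starts with a pair of the one kind and ends with a pair of
the other. -/
theorem exists_transition {S : Finset V} {D : ℕ}
    (hD : ∀ v ∈ S, outMissing G v S + inMissing G v S ≤ D) (hS : 5 * D < 2 * S.card)
    (f : V → ℕ) (s : ℕ)
    (hlow : ∃ x ∈ S, ∃ y ∈ S, G x y ∧ s ≤ f x + f y)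
    (hhigh : ∃ x ∈ S, ∃ y ∈ S, G x y ∧ f x + f y < s) :
    ∃ x ∈ S, ∃ y ∈ S, ∃ z ∈ S, G x y ∧ G y z ∧ G x z ∧ s ≤ f x + f y ∧ f y + f z < s := by
  classical
  by_contra! H
  obtain ⟨P, memP⟩ : ∃ P : V → Finset V, ∀ {x y}, x ∈ P y ↔ x ∈ S ∧ G x y ∧ s ≤ f x + f y :=
    ⟨fun y => S.filter fun x => G x y ∧ s ≤ f x + f y, by simp⟩
  obtain ⟨Q, memQ⟩ : ∃ Q : V → Finset V, ∀ {z y}, z ∈ Q y ↔ z ∈ S ∧ G y z ∧ f y + f z < s :=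
    ⟨fun y => S.filter fun z => G y z ∧ f y + f z < s, by simp⟩
  have hPS : ∀ y, P y ⊆ S := fun y x hx => (memP.1 hx).1
  have hQS : ∀ y, Q y ⊆ S := fun y x hx => (memQ.1 hx).1
  have hbound : ∀ v ∈ S, ∀ A ⊆ S, ∀ B ⊆ S, (∀ w ∈ A, ¬ G v w) → (∀ w ∈ B, ¬ G w v) →
      A.card + B.card ≤ D := fun v hv A hA B hB h1 h2 =>
    (add_le_add (card_le_outMissing hA h1) (card_le_inMissing hB h2)).trans (hD v hv)
  have hno : ∀ y ∈ S, ∀ x ∈ P y, ∀ z ∈ Q y, ¬ G x z := by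
    intro y hy x hx z hz hxz
    obtain ⟨hx, hxy, h1⟩ := memP.1 hx
    obtain ⟨hz, hyz, h2⟩ := memQ.1 hz
    exact absurd (H x hx y hy z hz hxy hyz hxz h1) (by omega)
  have hPQ : ∀ y ∈ S, S.card ≤ (P y).card + (Q y).card + D := by
    intro y hy
    have hsub : S ⊆ (P y ∪ Q y) ∪ (S.filter (fun w => ¬ G y w) ∪ S.filter (fun w => ¬ G w y)) := by
      intro w hw
      simp only [Finset.mem_union, memP, memQ, Finset.mem_filter, hw, true_and]
      rcases le_or_gt s (f w + f y) with h | h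
      · tauto
      · have : f y + f w < s := by omega
        tauto
    have h1 := Finset.card_le_card hsub
    have h2 := Finset.card_union_le (P y ∪ Q y)
      (S.filter (fun w => ¬ G y w) ∪ S.filter (fun w => ¬ G w y))
    have h3 := Finset.card_union_le (P y) (Q y)
    have h4 := Finset.card_union_le (S.filter (fun w => ¬ G y w)) (S.filter (fun w => ¬ G w y))
    have h5 := hD y hy
    unfold outMissing inMissing at h5
    omega
  have hPle : ∀ y ∈ S, (Q y).Nonempty → (P y).card ≤ D := by
    rintro y hy ⟨z, hz⟩
    have := hbound z (hQS y hz) ∅ (by simp) (P y) (hPS y) (by simp)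
      (fun x hx => hno y hy x hx z hz)
    simpa using this
  have hQle : ∀ y ∈ S, (P y).Nonempty → (Q y).card ≤ D := by
    rintro y hy ⟨x, hx⟩
    have := hbound x (hPS y hx) (Q y) (hQS y) ∅ (by simp) (fun z hz => hno y hy x hx z hz)
      (by simp)
    simpa using this
  have hW : ∀ x ∈ S, ∀ y ∈ S, (P x).Nonempty → (Q x).Nonempty → (P y).Nonempty →
      (Q y).Nonempty → ¬ G x y := by
    intro x hx y hy hPx hQx hPy hQy hxy
    have a1 := hPQ x hx
    have a2 := hPQ y hy
    have b1 := hPle x hx hQx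
    have b2 := hPle y hy hQy
    have b3 := hQle x hx hPx
    have b4 := hQle y hy hPy
    have hdisj : Disjoint (P x) (P y) ∧ Disjoint (Q x) (Q y) := by
      rcases le_or_gt s (f x + f y) with h | h
      · have hQd : Disjoint (Q x) (Q y) := Finset.disjoint_left.2 fun z hz hz' =>
          hno y hy x (memP.2 ⟨hx, hxy, h⟩) z hz' (memQ.1 hz).2.1
        refine ⟨Finset.disjoint_left.2 fun p hp hp' => ?_, hQd⟩
        have := hbound p (hPS x hp) (Q x ∪ Q y) (Finset.union_subset (hQS x) (hQS y)) ∅ (by simp)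
          (fun z hz => (Finset.mem_union.1 hz).elim (hno x hx p hp z) (hno y hy p hp' z)) (by simp)
        rw [Finset.card_union_of_disjoint hQd, Finset.card_empty] at this
        omega
      · have hPd : Disjoint (P x) (P y) := Finset.disjoint_left.2 fun z hz hz' =>
          hno x hx z hz y (memQ.2 ⟨hy, hxy, h⟩) (memP.1 hz').2.1
        refine ⟨hPd, Finset.disjoint_left.2 fun p hp hp' => ?_⟩
        have := hbound p (hQS x hp) ∅ (by simp) (P x ∪ P y)
          (Finset.union_subset (hPS x) (hPS y)) (by simp) (fun z hz =>
            (Finset.mem_union.1 hz).elim (fun hz => hno x hx z hz p hp)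
              (fun hz => hno y hy z hz p hp'))
        rw [Finset.card_union_of_disjoint hPd, Finset.card_empty] at this
        omega
    have hcross : ∀ u ∈ S, ∀ v ∈ S, ∀ p ∈ P u, p ∈ Q v → (Q u).card + (P v).card ≤ D :=
      fun u hu v hv p hp hp' => hbound p (hPS u hp) (Q u) (hQS u) (P v) (hPS v)
        (hno u hu p hp) (fun w hw => hno v hv w hw p hp')
    by_cases hc1 : ∃ p ∈ P x, p ∈ Q y
    · obtain ⟨p, h1, h2⟩ := hc1
      have := hcross x hx y hy p h1 h2
      omega
    by_cases hc2 : ∃ p ∈ P y, p ∈ Q x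
    · obtain ⟨p, h1, h2⟩ := hc2
      have := hcross y hy x hx p h1 h2
      omega
    have hself : ∀ u, Disjoint (P u) (Q u) := fun u => Finset.disjoint_left.2 fun p h1 h2 => by
      have := (memP.1 h1).2.2
      have := (memQ.1 h2).2.2
      omega
    push Not at hc1 hc2
    have hd1 : Disjoint (P x) (Q y) := Finset.disjoint_left.2 hc1
    have hd2 : Disjoint (P y) (Q x) := Finset.disjoint_left.2 hc2
    have hcard : ((P x ∪ P y) ∪ (Q x ∪ Q y)).card =
        (P x).card + (P y).card + ((Q x).card + (Q y).card) := by
      rw [Finset.card_union_of_disjoint, Finset.card_union_of_disjoint hdisj.1,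
        Finset.card_union_of_disjoint hdisj.2]
      rw [Finset.disjoint_union_left, Finset.disjoint_union_right, Finset.disjoint_union_right]
      exact ⟨⟨hself x, hd1⟩, hd2, hself y⟩
    have := Finset.card_le_card (Finset.union_subset (Finset.union_subset (hPS x) (hPS y))
      (Finset.union_subset (hQS x) (hQS y)))
    omega
  set W := S.filter fun y => (P y).Nonempty ∧ (Q y).Nonempty with hWdef
  set X := S.filter fun y => Q y = ∅ with hX
  set Y := S.filter fun y => P y = ∅ with hY
  have hWcard : 2 * W.card ≤ D := by
    rcases W.eq_empty_or_nonempty with h | ⟨w, hw⟩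
    · simp [h]
    have hww := Finset.mem_filter.1 hw
    have := hbound w hww.1 W (Finset.filter_subset _ _) W (Finset.filter_subset _ _)
      (fun v hv => by
        have hvv := Finset.mem_filter.1 hv
        exact hW w hww.1 v hvv.1 hww.2.1 hww.2.2 hvv.2.1 hvv.2.2)
      (fun v hv => by
        have hvv := Finset.mem_filter.1 hv
        exact hW v hvv.1 w hww.1 hvv.2.1 hvv.2.2 hww.2.1 hww.2.2)
    omega
  have hXY : ∀ x ∈ X, ∀ y ∈ Y, ¬ G x y := by
    intro x hx y hy hxy
    obtain ⟨hx, hx'⟩ := Finset.mem_filter.1 hx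
    obtain ⟨hy, hy'⟩ := Finset.mem_filter.1 hy
    rcases le_or_gt s (f x + f y) with h | h
    · exact Finset.notMem_empty x (hy' ▸ memP.2 ⟨hx, hxy, h⟩)
    · exact Finset.notMem_empty y (hx' ▸ memQ.2 ⟨hy, hxy, h⟩)
  have hcover : ∀ y ∈ S, y ∈ X ∨ y ∈ Y ∨ y ∈ W := by
    intro y hy
    simp only [hX, hY, hWdef, Finset.mem_filter, hy, true_and, Finset.nonempty_iff_ne_empty]
    tauto
  rcases X.eq_empty_or_nonempty with hXe | ⟨x, hx⟩
  · obtain ⟨x, hx, w, hw, hxw, hlow⟩ := hlow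
    have hPw : (P w).Nonempty := ⟨x, memP.2 ⟨hx, hxw, hlow⟩⟩
    have hQw : (Q w).Nonempty := by
      rw [Finset.nonempty_iff_ne_empty]
      intro h
      exact Finset.notMem_empty w (hXe ▸ Finset.mem_filter.2 ⟨hw, h⟩)
    have hsub : S \ Q w ⊆ S.filter fun v => ¬ G w v := by
      intro v hv
      obtain ⟨hv, hv'⟩ := Finset.mem_sdiff.1 hv
      refine Finset.mem_filter.2 ⟨hv, fun hwv => ?_⟩
      rcases hcover v hv with h | h | h
      · simp [hXe] at h
      · have hvY := (Finset.mem_filter.1 h).2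
        refine hv' (memQ.2 ⟨hv, hwv, ?_⟩)
        by_contra! hc
        exact Finset.notMem_empty w (hvY ▸ memP.2 ⟨hw, hwv, hc⟩)
      · have := (Finset.mem_filter.1 h).2
        exact hW w hw v hv hPw hQw this.1 this.2 hwv
    have h1 := Finset.card_le_card hsub
    have h2 := hD w hw
    have h3 := hQle w hw hPw
    have h4 := Finset.le_card_sdiff (Q w) S
    unfold outMissing at h2
    omega
  rcases Y.eq_empty_or_nonempty with hYe | ⟨y, hy⟩
  · obtain ⟨w, hw, z, hz, hwz, hhigh⟩ := hhigh
    have hQw : (Q w).Nonempty := ⟨z, memQ.2 ⟨hz, hwz, hhigh⟩⟩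
    have hPw : (P w).Nonempty := by
      rw [Finset.nonempty_iff_ne_empty]
      intro h
      exact Finset.notMem_empty w (hYe ▸ Finset.mem_filter.2 ⟨hw, h⟩)
    have hsub : S \ P w ⊆ S.filter fun v => ¬ G v w := by
      intro v hv
      obtain ⟨hv, hv'⟩ := Finset.mem_sdiff.1 hv
      refine Finset.mem_filter.2 ⟨hv, fun hvw => ?_⟩
      rcases hcover v hv with h | h | h
      · have hvX := (Finset.mem_filter.1 h).2
        refine hv' (memP.2 ⟨hv, hvw, ?_⟩)
        by_contra! hc
        exact Finset.notMem_empty w (hvX ▸ memQ.2 ⟨hw, hvw, hc⟩)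
      · simp [hYe] at h
      · have := (Finset.mem_filter.1 h).2
        exact hW v hv w hw this.1 this.2 hPw hQw hvw
    have h1 := Finset.card_le_card hsub
    have h2 := hD w hw
    have h3 := hPle w hw hQw
    have h4 := Finset.le_card_sdiff (P w) S
    unfold inMissing at h2
    omega
  have h1 := hbound x (Finset.mem_filter.1 hx).1 Y (Finset.filter_subset _ _) ∅ (by simp)
    (hXY x hx) (by simp)
  have h2 := hbound y (Finset.mem_filter.1 hy).1 ∅ (by simp) X (Finset.filter_subset _ _)
    (by simp) (fun v hv => hXY v hv y hy)
  have h3 : S ⊆ X ∪ (Y ∪ W) := fun v hv => by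
    simpa only [Finset.mem_union] using hcover v hv
  have h4 := Finset.card_le_card h3
  have h5 := Finset.card_union_le X (Y ∪ W)
  have h6 := Finset.card_union_le Y W
  rw [Finset.card_empty] at h1 h2
  omega

theorem exists_common_outNeighbor {S : Finset V} (x y : V)
    (h : outMissing G x S + outMissing G y S < S.card) : ∃ z ∈ S, G x z ∧ G y z := by
  classical
  by_contra! hcon
  have hsub : S ⊆ S.filter (fun w => ¬ G x w) ∪ S.filter (fun w => ¬ G y w) := by
    intro w hw
    have := hcon w hw
    simp only [Finset.mem_union, Finset.mem_filter, hw, true_and]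
    tauto
  have h1 := Finset.card_le_card hsub
  have h2 := Finset.card_union_le (S.filter (fun w => ¬ G x w)) (S.filter (fun w => ¬ G y w))
  unfold outMissing at h
  omega

theorem exists_common_inNeighbor {S : Finset V} (x y : V)
    (h : inMissing G x S + inMissing G y S < S.card) : ∃ z ∈ S, G z x ∧ G z y :=
  exists_common_outNeighbor (G := fun a b => G b a) x y h

theorem exists_jump {S : Finset V} {D : ℕ} {f : V → ℕ}
    (hout : ∀ v, outMissing G v S ≤ f v) (hin : ∀ v, inMissing G v S + f v ≤ D) {x y z w : V}
    (h : 5 * D + 2 * (f x + f y) < 2 * S.card + 2 * (f z + f w)) :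
    ∃ t ∈ S, ∃ t' ∈ S, G t t' ∧ (G x t ∧ G y t ∧ G t z ∧ G t w) ∧
      (G x t' ∧ G y t' ∧ G t' z ∧ G t' w) := by
  classical
  set T := S.filter fun t => G x t ∧ G y t ∧ G t z ∧ G t w with hT
  have hTS : T ⊆ S := Finset.filter_subset _ _
  have hcard : S.card ≤ T.card + outMissing G x S + outMissing G y S + inMissing G z S
      + inMissing G w S := by
    have hsub : S ⊆ (((T ∪ S.filter (fun t => ¬ G x t)) ∪ S.filter (fun t => ¬ G y t))
        ∪ S.filter (fun t => ¬ G t z)) ∪ S.filter (fun t => ¬ G t w) := by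
      intro t ht
      simp only [hT, Finset.mem_union, Finset.mem_filter, ht, true_and]
      tauto
    refine (Finset.card_le_card hsub).trans ?_
    unfold outMissing inMissing
    refine (Finset.card_union_le _ _).trans (Nat.add_le_add_right ?_ _)
    refine (Finset.card_union_le _ _).trans (Nat.add_le_add_right ?_ _)
    refine (Finset.card_union_le _ _).trans (Nat.add_le_add_right ?_ _)
    exact Finset.card_union_le _ _
  have hx := hout x
  have hy := hout y
  have hz := hin z
  have hw := hin w
  obtain ⟨t, ht⟩ : T.Nonempty := Finset.card_pos.1 (by omega)
  by_contra! hcon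
  have hmem : ∀ {t}, t ∈ T → t ∈ S ∧ G x t ∧ G y t ∧ G t z ∧ G t w := fun h => by
    simpa [hT] using h
  have hnone : ∀ a ∈ T, ∀ b ∈ T, ¬ G a b := by
    intro a ha b hb hab
    have ha' := hmem ha
    have hb' := hmem hb
    exact hcon a ha'.1 b hb'.1 hab ha'.2 hb'.2.1 hb'.2.2.1 hb'.2.2.2.1 hb'.2.2.2.2
  have h1 := card_le_outMissing hTS (hnone t ht)
  have h2 := card_le_inMissing hTS fun a ha => hnone a ha t ht
  have h3 := hout t
  have h4 := hin t
  omega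

/-- Any two edges are joined by a short square path through `S`. -/
theorem exists_connection [DecidableEq V] {D E : ℕ} {f : V → ℕ} (hG : ∀ v, ¬ G v v)
    (k : ℕ) (S : Finset V) (hout : ∀ v, outMissing G v S ≤ f v)
    (hin : ∀ v, inMissing G v S + f v ≤ D)
    (hS : 5 * D + 2 * E + 10 * k + 4 < 2 * S.card) {x y c d : V} (hxy : G x y) (hcd : G c d)
    (hk : f x + f y ≤ k * E) :
    ∃ q : List V, q.Nodup ∧ q.toFinset ⊆ S ∧ q.length ≤ 5 * k + 4 ∧
      IsSqPath G (x :: y :: (q ++ [c, d])) := by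
  induction k generalizing S x y with
  | zero =>
    obtain ⟨t, ht, t', ht', htt, h1, h2⟩ := exists_jump hout hin (x := x) (y := y) (z := c) (w := d)
      (by omega)
    refine ⟨[t, t'], ?_, ?_, by simp, ?_⟩
    · simp only [List.nodup_cons, List.mem_singleton, List.not_mem_nil, not_false_eq_true,
        List.nodup_nil, and_true]
      rintro rfl
      exact hG _ htt
    · intro w hw
      simp only [List.mem_toFinset, List.mem_cons, List.not_mem_nil, or_false] at hw
      rcases hw with rfl | rfl <;> assumption
    · simp only [List.cons_append, List.nil_append, IsSqPath]
      tauto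
  | succ k ih =>
    have hne : ∀ {a b}, G a b → a ≠ b := fun h h' => hG _ (h' ▸ h)
    have hDS : ∀ v, outMissing G v S + inMissing G v S ≤ D := fun v => by
      have := hout v
      have := hin v
      omega
    have hDle : ∀ v, f v ≤ D := fun v => by
      have := hin v
      omega
    have hrec : ∀ U : Finset V, U.card ≤ 5 → ∀ a b, G a b → f a + f b + E < f x + f y →
        ∃ q : List V, q.Nodup ∧ q.toFinset ⊆ S \ U ∧ q.length ≤ 5 * k + 4 ∧
          IsSqPath G (a :: b :: (q ++ [c, d])) := by
      intro U hU a b hab hlt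
      have hcard := Finset.le_card_sdiff U S
      refine ih (S \ U)
        (fun v => (outMissing_mono v Finset.sdiff_subset).trans (hout v))
        (fun v => (Nat.add_le_add_right (inMissing_mono v Finset.sdiff_subset) _).trans (hin v))
        (by omega) hab ?_
      rw [Nat.succ_mul] at hk
      omega
    by_cases hlow : ∃ u ∈ S, ∃ v ∈ S, G u v ∧ f x + f y - E ≤ f u + f v
    swap
    · push Not at hlow
      obtain ⟨u, hu, hxu, hyu⟩ := exists_common_outNeighbor (G := G) (S := S) x y (by
        have h1 := hDS x
        have h2 := hDS y
        omega)
      obtain ⟨v, hv, hyv, huv⟩ := exists_common_outNeighbor (G := G) (S := S) y u (by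
        have h1 := hDS y
        have h2 := hDS u
        omega)
      obtain ⟨q, hq, hqS, hlen, hp⟩ := hrec {u, v} ((Finset.card_le_two).trans (by omega)) u v huv
        (by
          have := hlow u hu v hv huv
          omega)
      have hnot : ∀ w ∈ q, w ∈ S ∧ w ≠ u ∧ w ≠ v := fun w hw => by
        simpa using hqS (List.mem_toFinset.2 hw)
      refine ⟨u :: v :: q, ?_, ?_, by simp; omega, ?_⟩
      · simp only [List.nodup_cons, List.mem_cons, not_or]
        exact ⟨⟨hne huv, fun h => (hnot u h).2.1 rfl⟩, fun h => (hnot v h).2.2 rfl, hq⟩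
      · intro w hw
        simp only [List.mem_toFinset, List.mem_cons] at hw
        rcases hw with rfl | rfl | hw
        exacts [hu, hv, (hnot w hw).1]
      · simp only [List.cons_append, IsSqPath]
        exact ⟨hxy, hxu, hyu, hyv, hp⟩
    by_cases hhigh : ∃ u ∈ S, ∃ v ∈ S, G u v ∧ f u + f v < f x + f y - E
    swap
    · push Not at hhigh
      obtain ⟨v, hv, hvc, hvd⟩ := exists_common_inNeighbor (G := G) (S := S) c d (by
        have h1 := hDS c
        have h2 := hDS d
        omega)
      obtain ⟨u, hu, huv, huc⟩ := exists_common_inNeighbor (G := G) (S := S) v c (by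
        have h1 := hDS v
        have h2 := hDS c
        omega)
      have hle := hhigh u hu v hv huv
      have hcard := Finset.le_card_sdiff ({u, v} : Finset V) S
      have htwo := Finset.card_le_two (a := u) (b := v)
      obtain ⟨t, ht, t', ht', htt, h1, h2⟩ := exists_jump (S := S \ {u, v})
        (fun v => (outMissing_mono v Finset.sdiff_subset).trans (hout v))
        (fun v => (Nat.add_le_add_right (inMissing_mono v Finset.sdiff_subset) _).trans (hin v))
        (x := x) (y := y) (z := u) (w := v) (by omega)
      simp only [Finset.mem_sdiff, Finset.mem_insert, Finset.mem_singleton, not_or] at ht ht'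
      refine ⟨[t, t', u, v], ?_, ?_, by simp, ?_⟩
      · have := hne htt
        have := hne huv
        simp only [List.nodup_cons, List.mem_cons, List.not_mem_nil, not_or, List.nodup_nil]
        tauto
      · intro w hw
        simp only [List.mem_toFinset, List.mem_cons, List.not_mem_nil, or_false] at hw
        rcases hw with rfl | rfl | rfl | rfl
        exacts [ht.1, ht'.1, hu, hv]
      · simp only [List.cons_append, List.nil_append, IsSqPath]
        tauto
    obtain ⟨a, ha, b, hb, e, he, hab, hbe, hae, hl, hh⟩ :=
      exists_transition (fun v _ => hDS v) (by omega) f (f x + f y - E) hlow hhigh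
    have hcard := Finset.le_card_sdiff ({a, b, e} : Finset V) S
    have hthree := Finset.card_le_three (a := a) (b := b) (c := e)
    obtain ⟨t, ht, t', ht', htt, h1, h2⟩ := exists_jump (S := S \ {a, b, e})
      (fun v => (outMissing_mono v Finset.sdiff_subset).trans (hout v))
      (fun v => (Nat.add_le_add_right (inMissing_mono v Finset.sdiff_subset) _).trans (hin v))
      (x := x) (y := y) (z := a) (w := b) (by omega)
    simp only [Finset.mem_sdiff, Finset.mem_insert, Finset.mem_singleton, not_or] at ht ht'
    obtain ⟨q, hq, hqS, hlen, hp⟩ := hrec {t, t', a, b, e} Finset.card_le_five b e hbe (by omega)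
    have hnot : ∀ w ∈ q, w ∈ S ∧ w ≠ t ∧ w ≠ t' ∧ w ≠ a ∧ w ≠ b ∧ w ≠ e := fun w hw => by
      simpa using hqS (List.mem_toFinset.2 hw)
    refine ⟨t :: t' :: a :: b :: e :: q, ?_, ?_, by simp; omega, ?_⟩
    · have := hne htt
      have := hne hab
      have := hne hbe
      have := hne hae
      have n1 : t ∉ q := fun h => (hnot _ h).2.1 rfl
      have n2 : t' ∉ q := fun h => (hnot _ h).2.2.1 rfl
      have n3 : a ∉ q := fun h => (hnot _ h).2.2.2.1 rfl
      have n4 : b ∉ q := fun h => (hnot _ h).2.2.2.2.1 rfl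
      have n5 : e ∉ q := fun h => (hnot _ h).2.2.2.2.2 rfl
      simp only [List.nodup_cons, List.mem_cons, not_or]
      tauto
    · intro w hw
      simp only [List.mem_toFinset, List.mem_cons] at hw
      rcases hw with rfl | rfl | rfl | rfl | rfl | hw
      exacts [ht.1, ht'.1, ha, hb, he, (hnot w hw).1]
    · simp only [List.cons_append, IsSqPath]
      tauto

end Connecting

section Covering

variable {V : Type*} {G : V → V → Prop}

theorem exists_sqPath_of_length [DecidableEq V] {U : Finset V} {g : ℕ} (hU : U.Nonempty)
    (h : ∀ x ∈ U, ∀ y ∈ U, inMissing G x U + inMissing G y U + g ≤ U.card) (m : ℕ) (hm : m ≤ g) :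
    ∃ l : List V, l.Nodup ∧ l.toFinset ⊆ U ∧ l.length = m ∧ IsSqPath G l := by
  induction m with
  | zero => exact ⟨[], by simp [IsSqPath]⟩
  | succ m ih =>
    obtain ⟨l, hl, hlU, hlen, hp⟩ := ih (by omega)
    have hext : ∀ x ∈ U, ∀ y ∈ U, ∃ z ∈ U \ l.toFinset, G z x ∧ G z y := by
      intro x hx y hy
      apply exists_common_inNeighbor
      have h1 := h x hx y hy
      have h2 := inMissing_mono (G := G) x (Finset.sdiff_subset : U \ l.toFinset ⊆ U)
      have h3 := inMissing_mono (G := G) y (Finset.sdiff_subset : U \ l.toFinset ⊆ U)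
      have h4 := Finset.le_card_sdiff l.toFinset U
      have h5 := l.toFinset_card_le
      omega
    obtain ⟨z, hz, hp'⟩ : ∃ z ∈ U \ l.toFinset, IsSqPath G (z :: l) := by
      rcases l with _ | ⟨x, _ | ⟨y, l⟩⟩
      · obtain ⟨x, hx⟩ := hU
        exact ⟨x, by simpa using hx, by simp [IsSqPath]⟩
      · have hx : x ∈ U := hlU (by simp)
        obtain ⟨z, hz, hzx, -⟩ := hext x hx x hx
        exact ⟨z, hz, by simpa [IsSqPath] using hzx⟩
      · obtain ⟨z, hz, hzx, hzy⟩ := hext x (hlU (by simp)) y (hlU (by simp))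
        exact ⟨z, hz, hzx, hzy, hp⟩
    obtain ⟨hzU, hzl⟩ := Finset.mem_sdiff.1 hz
    refine ⟨z :: l, List.nodup_cons.2 ⟨by simpa using hzl, hl⟩, ?_, by simp [hlen], hp'⟩
    rw [List.toFinset_cons]
    exact Finset.insert_subset hzU hlU

theorem exists_eq_append_pair {l : List V} (h : 2 ≤ l.length) : ∃ l₀ x y, l = l₀ ++ [x, y] := by
  rcases List.eq_nil_or_concat l with rfl | ⟨l₁, y, rfl⟩
  · simp at h
  rcases List.eq_nil_or_concat l₁ with rfl | ⟨l₀, x, rfl⟩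
  · simp at h
  exact ⟨l₀, x, y, by simp⟩

theorem exists_eq_cons_cons {l : List V} (h : 2 ≤ l.length) : ∃ x y l₀, l = x :: y :: l₀ := by
  rcases l with _ | ⟨x, _ | ⟨y, l⟩⟩
  · simp at h
  · simp at h
  · exact ⟨x, y, l, rfl⟩

/-- A small set `R` through which edges can be joined yields a spanning square cycle. -/
theorem exists_spanning_sqCycle [DecidableEq V] [Fintype V] (hG : ∀ v, ¬ G v v) {D DR E k g J : ℕ}
    {R : Finset V}
    (hD : ∀ v, outMissing G v Finset.univ + inMissing G v Finset.univ ≤ D)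
    (hDR : ∀ v, outMissing G v R + inMissing G v R ≤ DR)
    (hk : 2 * DR ≤ k * E) (hg : 2 ≤ g) (hJ : Fintype.card V < J * g)
    (hgain : g + R.card + 2 * D + 3 ≤ Fintype.card V)
    (hR : 5 * DR + 2 * E + 10 * k + 4 + 2 * (J * (5 * k + 4)) < 2 * R.card) :
    ∃ (L : List V) (a b : V), L.Nodup ∧ (∀ v, v ∈ L) ∧ L.take 2 = [a, b] ∧
      IsSqPath G (L ++ [a, b]) := by
  have hconn : ∀ l : List V, (l.toFinset ∩ R).card ≤ J * (5 * k + 4) → ∀ x y c d, G x y → G c d →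
      ∃ q : List V, q.Nodup ∧ q.toFinset ⊆ R \ l.toFinset ∧ q.length ≤ 5 * k + 4 ∧
        IsSqPath G (x :: y :: (q ++ [c, d])) := by
    intro l hl x y c d hxy hcd
    have hcard : R.card ≤ (R \ l.toFinset).card + (l.toFinset ∩ R).card := by
      rw [Finset.inter_comm, Finset.card_sdiff_add_card_inter]
    refine exists_connection (D := DR) (E := E) (f := fun v => outMissing G v R) hG k _
      (fun v => outMissing_mono v Finset.sdiff_subset) (fun v => ?_) (by omega) hxy hcd ?_
    · have h1 := inMissing_mono (G := G) v (Finset.sdiff_subset : R \ l.toFinset ⊆ R)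
      have h2 := hDR v
      omega
    · have h1 := hDR x
      have h2 := hDR y
      omega
  have hcompl : (Finset.univ \ R).card + R.card = Fintype.card V := by
    rw [Finset.card_sdiff_add_card_eq_card (Finset.subset_univ R), Finset.card_univ]
  have hloop : ∀ j ≤ J, ∃ l : List V, l.Nodup ∧ IsSqPath G l ∧ 2 ≤ l.length ∧
      (l.toFinset ∩ R).card ≤ j * (5 * k + 4) ∧
      (Finset.univ \ R ⊆ l.toFinset ∨ j * g ≤ l.length) := by
    intro j
    induction j with
    | zero =>
      intro _
      obtain ⟨l, h1, h2, h3, h4⟩ := exists_sqPath_of_length (G := G) (U := Finset.univ \ R) (g := g)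
        (Finset.card_pos.1 (by omega)) (fun x _ y _ => by
          have h1 := inMissing_mono (G := G) x (Finset.subset_univ (Finset.univ \ R))
          have h2 := inMissing_mono (G := G) y (Finset.subset_univ (Finset.univ \ R))
          have h3 := hD x
          have h4 := hD y
          omega) 2 hg
      refine ⟨l, h1, h4, h3.ge, ?_, Or.inr (by simp)⟩
      rw [Finset.disjoint_iff_inter_eq_empty.1 (Finset.disjoint_of_subset_left h2
        Finset.sdiff_disjoint)]
      simp
    | succ j ih =>
      intro hj
      obtain ⟨l, hl, hp, hl2, hlR, halt⟩ := ih (by omega)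
      have hmul : (j + 1) * (5 * k + 4) = j * (5 * k + 4) + (5 * k + 4) := Nat.succ_mul _ _
      have hmul' : (j + 1) * (5 * k + 4) ≤ J * (5 * k + 4) := Nat.mul_le_mul_right _ hj
      rcases halt with halt | halt
      · exact ⟨l, hl, hp, hl2, by omega, Or.inl halt⟩
      obtain ⟨l', hl', hp', -, hdiff, hlen, hsat⟩ :=
        exists_saturated (G := G) (Finset.univ \ R) (T := []) l hl (by simpa using hp)
      rw [List.append_nil] at hp'
      have hl'R : (l'.toFinset ∩ R).card ≤ j * (5 * k + 4) := by
        have hsd : ∀ s : Finset V, s \ (Finset.univ \ R) = s ∩ R := fun s => by ext; simp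
        rw [hsd, hsd] at hdiff
        rw [hdiff]
        exact hlR
      obtain ⟨U, hU⟩ : ∃ U, U = (Finset.univ \ R) \ l'.toFinset := ⟨_, rfl⟩
      have hUl : Disjoint U l'.toFinset := hU ▸ Finset.sdiff_disjoint
      have hUcard : (Finset.univ \ R).card - l'.toFinset.card ≤ U.card :=
        hU ▸ Finset.le_card_sdiff _ _
      rcases U.eq_empty_or_nonempty with hUe | hUne
      · exact ⟨l', hl', hp', by omega, by omega,
          Or.inl (Finset.sdiff_eq_empty_iff_subset.1 (hU ▸ hUe))⟩
      have hmiss : ∀ x ∈ U, 2 * inMissing G x U + l'.length ≤ 2 * D + 3 := by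
        intro x hx
        obtain ⟨hxR, hxl⟩ := Finset.mem_sdiff.1 (hU ▸ hx)
        have h1 := hsat x hxR (by simpa using hxl)
        have h2 := inMissing_union_of_disjoint (G := G) x hUl
        have h3 := inMissing_mono (G := G) x (Finset.subset_univ (U ∪ l'.toFinset))
        have h4 := outMissing_mono (G := G) x (Finset.subset_univ l'.toFinset)
        have h5 := hD x
        omega
      obtain ⟨P, hP, hPU, hPlen, hPp⟩ := exists_sqPath_of_length (G := G) (U := U) (g := g) hUne
        (fun x hx y hy => by
          have h1 := hmiss x hx
          have h2 := hmiss y hy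
          have h3 := l'.toFinset_card_le
          omega) g le_rfl
      obtain ⟨l₀, x, y, rfl⟩ := exists_eq_append_pair (l := l') (by omega)
      obtain ⟨c, d, P₀, rfl⟩ := exists_eq_cons_cons (l := P) (by omega)
      have hxy : G x y := by
        simpa [IsSqPath] using ((isSqPath_append_iff l₀ [] x y).1 hp').2
      have hcd : G c d := by
        simpa [IsSqPath] using ((isSqPath_append_iff [] P₀ c d).1 hPp).1
      obtain ⟨q, hq, hqR, hqlen, hqp⟩ := hconn _ (hl'R.trans (by omega)) x y c d hxy hcd
      have hqR' : ∀ w ∈ q, w ∈ R ∧ w ∉ l₀ ++ [x, y] := fun w hw => by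
        simpa only [Finset.mem_sdiff, List.mem_toFinset] using hqR (List.mem_toFinset.2 hw)
      have hPU' : ∀ w ∈ c :: d :: P₀, w ∉ R ∧ w ∉ l₀ ++ [x, y] := fun w hw => by
        simpa only [hU, Finset.mem_sdiff, List.mem_toFinset, Finset.mem_univ, true_and] using
          hPU (List.mem_toFinset.2 hw)
      refine ⟨(l₀ ++ [x, y]) ++ (q ++ c :: d :: P₀), ?_, ?_, ?_, ?_, Or.inr ?_⟩
      · refine hl'.append (hq.append hP fun w h1 h2 => (hPU' w h2).1 (hqR' w h1).1)
          fun w h1 h2 => ?_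
        rcases List.mem_append.1 h2 with h2 | h2
        · exact (hqR' w h2).2 h1
        · exact (hPU' w h2).2 h1
      · rw [List.append_assoc]
        refine (isSqPath_append_iff l₀ (q ++ c :: d :: P₀) x y).2 ⟨hp', ?_⟩
        exact (isSqPath_append_iff (x :: y :: q) P₀ c d).2 ⟨by simpa using hqp, hPp⟩
      · simp
        omega
      · have hsub : ((l₀ ++ [x, y]) ++ (q ++ c :: d :: P₀)).toFinset ∩ R ⊆
            ((l₀ ++ [x, y]).toFinset ∩ R) ∪ q.toFinset := by
          intro w hw
          obtain ⟨hw, hwR⟩ := Finset.mem_inter.1 hw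
          rw [Finset.mem_union, Finset.mem_inter, List.mem_toFinset, List.mem_toFinset]
          rcases List.mem_append.1 (List.mem_toFinset.1 hw) with hw | hw
          · exact Or.inl ⟨hw, hwR⟩
          rcases List.mem_append.1 hw with hw | hw
          · exact Or.inr hw
          · exact absurd hwR (hPU' w hw).1
        have h1 := (Finset.card_le_card hsub).trans (Finset.card_union_le _ _)
        have h2 := q.toFinset_card_le
        omega
      · have : (j + 1) * g = j * g + g := Nat.succ_mul _ _
        rw [List.length_append, List.length_append (as := q), hPlen]
        omega
  obtain ⟨l, hl, hp, hl2, hlR, halt⟩ := hloop J le_rfl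
  have hlcard := hl.length_le_card
  replace halt := halt.resolve_right (by omega)
  obtain ⟨a, b, l₁, rfl⟩ := exists_eq_cons_cons hl2
  obtain ⟨l₀, x, y, hlxy⟩ := exists_eq_append_pair hl2
  have hab : G a b := by
    simpa [IsSqPath] using ((isSqPath_append_iff [] l₁ a b).1 hp).1
  have hxy : G x y := by
    rw [hlxy] at hp
    simpa [IsSqPath] using ((isSqPath_append_iff l₀ [] x y).1 hp).2
  obtain ⟨q, hq, hqR, -, hqp⟩ := hconn _ hlR x y a b hxy hab
  obtain ⟨L, hL, hLp, hLt, -, hlen, hsat⟩ :=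
    exists_saturated (G := G) Finset.univ (T := [a, b]) ((a :: b :: l₁) ++ q)
      (hl.append hq fun w h1 h2 => by
        have := Finset.mem_sdiff.1 (hqR (List.mem_toFinset.2 h2))
        exact this.2 (List.mem_toFinset.2 h1))
      (by
        rw [hlxy, List.append_assoc, List.append_assoc]
        exact (isSqPath_append_iff l₀ (q ++ [a, b]) x y).2 ⟨hlxy ▸ hp, hqp⟩)
  refine ⟨L, a, b, hL, fun u => ?_, by simpa using hLt, hLp⟩
  by_contra hu
  have h1 := hsat u (Finset.mem_univ u) hu
  have h2 := outMissing_mono (G := G) u (Finset.subset_univ L.toFinset)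
  have h3 := inMissing_mono (G := G) u (Finset.subset_univ L.toFinset)
  have h4 := hD u
  have h5 := Finset.card_le_card halt
  have h6 := (a :: b :: l₁).toFinset_card_le
  rw [List.length_append] at hlen
  omega

theorem hasPowHamCycle_two_of_sqCycle {n : ℕ} {G : Fin n → Fin n → Prop} {L : List (Fin n)}
    {a b : Fin n} (hL : L.Nodup) (hmem : ∀ v, v ∈ L) (htake : L.take 2 = [a, b])
    (hp : IsSqPath G (L ++ [a, b])) : HasPowHamCycle 2 G := by
  have hlen : L.length = n := by
    rw [← List.toFinset_card_of_nodup hL, Finset.eq_univ_of_forall fun v =>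
      List.mem_toFinset.2 (hmem v), Finset.card_univ, Fintype.card_fin]
  refine ⟨(finCongr hlen.symm).trans (hL.getEquivOfForallMemList L hmem), fun i j hj1 hj2 => ?_⟩
  have hi := i.isLt
  obtain ⟨x, y, L', rfl⟩ := exists_eq_cons_cons (l := L) (by
    have := congrArg List.length htake
    simp at this
    omega)
  simp at htake
  obtain ⟨rfl, rfl⟩ := htake
  have h := hp.adj_getElem i (i + j) (by omega) (by omega) (by simp at hlen ⊢; omega)
  simp only [Equiv.trans_apply, finCongr_apply, List.Nodup.getEquivOfForallMemList_apply,
    List.get_eq_getElem, Fin.val_cast]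
  rw [List.getElem_append_left (by omega)] at h
  convert h using 1
  rcases lt_or_ge ((i : ℕ) + j) n with hlt | hge
  · simp only [Nat.mod_eq_of_lt hlt]
    rw [List.getElem_append_left]
  · rw [List.getElem_append_right (by omega)]
    simp only [List.length_cons] at hlen
    have hn : 2 ≤ n := by omega
    obtain h0 | h0 : (i : ℕ) + j = n ∨ (i : ℕ) + j = n + 1 := by omega
    · simp [h0, hlen]
    · have : (n + 1) % n = 1 := by
        rw [Nat.add_mod_left, Nat.mod_eq_of_lt (by omega)]
      simp [h0, hlen, this]

end Covering

section RandomSubset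

open Real

variable {V ι : Type*} [Fintype V] [DecidableEq V]

theorem sum_powerset_binomial_exp_le {p t : ℝ} (hp : 0 ≤ p) (hp1 : p ≤ 1) (f : V → ℝ)
    (hf : ∀ v, |t * f v| ≤ 1) :
    ∑ S : Finset V, p ^ S.card * (1 - p) ^ Sᶜ.card * exp (t * ∑ v ∈ S, f v) ≤
      exp (p * t * ∑ v, f v + ∑ v, (t * f v) ^ 2) := by
  have hprod : ∑ S : Finset V, p ^ S.card * (1 - p) ^ Sᶜ.card * exp (t * ∑ v ∈ S, f v) =
      ∏ v, (p * exp (t * f v) + (1 - p)) := by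
    rw [Finset.prod_add, Finset.powerset_univ]
    refine Finset.sum_congr rfl fun S _ => ?_
    rw [Finset.prod_mul_distrib, Finset.prod_const, Finset.prod_const, ← exp_sum, Finset.mul_sum,
      ← Finset.compl_eq_univ_sdiff]
    ring
  rw [hprod, Finset.mul_sum, ← Finset.sum_add_distrib, exp_sum]
  refine Finset.prod_le_prod (fun v _ => ?_) fun v _ => ?_
  · have := exp_pos (t * f v)
    have := sub_nonneg.2 hp1
    positivity
  · have h1 := (abs_le.1 (abs_exp_sub_one_sub_id_le (hf v))).2
    have h2 := add_one_le_exp (p * t * f v + (t * f v) ^ 2)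
    have h3 := mul_le_mul_of_nonneg_left h1 hp
    have h4 := mul_le_of_le_one_left (sq_nonneg (t * f v)) hp1
    linarith

/-- A random subset of density `p` is close to its expectation for few bounded functions at
once. -/
theorem exists_finset_sum_le [Fintype ι] {p ε : ℝ} (hp : 0 ≤ p) (hp1 : p ≤ 1) (hε : 0 ≤ ε)
    (hε1 : ε ≤ 1) (f : ι → V → ℝ) (hf : ∀ i v, |f i v| ≤ 2)
    (hcard : Fintype.card ι * exp (-(ε ^ 2 * Fintype.card V / 16)) < 1) :
    ∃ S : Finset V, ∀ i, ∑ v ∈ S, f i v ≤ p * ∑ v, f i v + ε * Fintype.card V := by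
  by_contra! hbad
  obtain ⟨t, ht⟩ : ∃ t, t = ε / 8 := ⟨_, rfl⟩
  have hweight : ∀ S : Finset V, 0 ≤ p ^ S.card * (1 - p) ^ Sᶜ.card := fun S =>
    mul_nonneg (pow_nonneg hp _) (pow_nonneg (sub_nonneg.2 hp1) _)
  have htotal : ∑ S : Finset V, p ^ S.card * (1 - p) ^ Sᶜ.card = 1 := by
    have := Finset.prod_add (fun _ : V => p) (fun _ => 1 - p) Finset.univ
    simp only [Finset.prod_const, Finset.powerset_univ, ← Finset.compl_eq_univ_sdiff,
      add_sub_cancel, one_pow] at this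
    exact this.symm
  have hi : ∀ i, ∑ S : Finset V, p ^ S.card * (1 - p) ^ Sᶜ.card *
      exp (t * ∑ v ∈ S, f i v - t * (p * ∑ v, f i v + ε * Fintype.card V)) ≤
      exp (-(ε ^ 2 * Fintype.card V / 16)) := by
    intro i
    have htf : ∀ v, |t * f i v| ≤ ε / 4 := fun v => by
      rw [abs_mul, ht, abs_of_nonneg (by positivity)]
      nlinarith [hf i v]
    have h1 := sum_powerset_binomial_exp_le hp hp1 (f i) fun v => (htf v).trans (by linarith)
    have h2 : ∑ v, (t * f i v) ^ 2 ≤ Fintype.card V * (ε / 4) ^ 2 := by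
      rw [← nsmul_eq_mul, ← Finset.card_univ]
      refine Finset.sum_le_card_nsmul _ _ _ fun v _ => ?_
      rw [← sq_abs]
      exact pow_le_pow_left₀ (abs_nonneg _) (htf v) 2
    simp only [exp_sub, ← mul_div_assoc, ← Finset.sum_div]
    rw [div_le_iff₀ (exp_pos _), ← exp_add]
    refine h1.trans (exp_le_exp.2 ?_)
    rw [ht] at h2 ⊢
    linarith
  have hone : (1 : ℝ) ≤ ∑ i, ∑ S : Finset V, p ^ S.card * (1 - p) ^ Sᶜ.card *
      exp (t * ∑ v ∈ S, f i v - t * (p * ∑ v, f i v + ε * Fintype.card V)) := by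
    rw [Finset.sum_comm]
    refine htotal.ge.trans (Finset.sum_le_sum fun S _ => ?_)
    rw [← Finset.mul_sum]
    refine le_mul_of_one_le_right (hweight S) ?_
    obtain ⟨i, hi⟩ := hbad S
    refine le_trans (one_le_exp ?_) (Finset.single_le_sum (f := fun i =>
      exp (t * ∑ v ∈ S, f i v - t * (p * ∑ v, f i v + ε * Fintype.card V)))
      (fun _ _ => (exp_pos _).le) (Finset.mem_univ i))
    rw [← mul_sub]
    exact mul_nonneg (by rw [ht]; positivity) (sub_nonneg.2 hi.le)
  have := hone.trans (Finset.sum_le_sum fun i _ => hi i)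
  rw [Finset.sum_const, Finset.card_univ, nsmul_eq_mul] at this
  linarith

end RandomSubset

section Reservoir

open Real

/-- A random set inherits the density of the missing edges at every vertex. -/
theorem exists_reservoir {V : Type*} [Fintype V] [DecidableEq V] (G : V → V → Prop) {p ε M : ℝ}
    (hp : 0 ≤ p) (hp1 : p ≤ 1) (hε : 0 ≤ ε) (hε1 : ε ≤ 1)
    (hM : ∀ v, ((outMissing G v Finset.univ + inMissing G v Finset.univ : ℕ) : ℝ) ≤ M)
    (hcard : (Fintype.card V + 2) * exp (-(ε ^ 2 * Fintype.card V / 16)) < 1) :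
    ∃ R : Finset V, (R.card : ℝ) ≤ (p + ε) * Fintype.card V ∧
      (p - ε) * Fintype.card V ≤ R.card ∧
      ∀ v, ((outMissing G v R + inMissing G v R : ℕ) : ℝ) ≤ p * M + ε * Fintype.card V := by
  classical
  let f : V ⊕ Bool → V → ℝ := Sum.elim
    (fun v w => (if ¬ G v w then 1 else 0) + if ¬ G w v then 1 else 0)
    (fun b _ => if b then 1 else -1)
  have hsum : ∀ v (S : Finset V), ∑ w ∈ S, f (Sum.inl v) w =
      ((outMissing G v S + inMissing G v S : ℕ) : ℝ) := by
    intro v S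
    simp only [f, Sum.elim_inl, Finset.sum_add_distrib, Finset.sum_boole, outMissing, inMissing,
      Nat.cast_add]
  obtain ⟨R, hR⟩ := exists_finset_sum_le hp hp1 hε hε1 f (by
    rintro (v | b) w
    · simp only [f, Sum.elim_inl]
      split_ifs <;> norm_num
    · simp only [f, Sum.elim_inr]
      split_ifs <;> norm_num) (by simpa using hcard)
  refine ⟨R, ?_, ?_, fun v => ?_⟩
  · have := hR (Sum.inr true)
    simp [f] at this
    linarith
  · have := hR (Sum.inr false)
    simp [f] at this
    linarith
  · have := hR (Sum.inl v)
    rw [hsum, hsum] at this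
    exact this.trans (by gcongr; exact hM v)

theorem add_two_mul_exp_neg_lt_one {c x : ℝ} (hc : 0 < c) (hx : 1 < x) (h : 4 / c ^ 2 ≤ x) :
    (x + 2) * exp (-(c * x)) < 1 := by
  rw [exp_neg, ← div_eq_mul_inv, div_lt_one (exp_pos _)]
  have h1 := quadratic_le_exp_of_nonneg (x := c * x) (by positivity)
  rw [div_le_iff₀ (by positivity)] at h
  have h2 : 4 * x ≤ (c * x) ^ 2 := by nlinarith
  have h3 : 0 < c * x := by positivity
  linarith

end Reservoir

theorem outDeg_add_outMissing {n : ℕ} (G : Fin n → Fin n → Prop) (v : Fin n) :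
    outDeg G v + outMissing G v Finset.univ = n := by
  classical
  have h := Finset.card_filter_add_card_filter_not (s := Finset.univ) (G v)
  rw [Finset.card_univ, Fintype.card_fin] at h
  rw [outDeg, outMissing, Set.ncard_eq_toFinset_card', Set.toFinset_ofPred]
  exact h

theorem inDeg_add_inMissing {n : ℕ} (G : Fin n → Fin n → Prop) (v : Fin n) :
    inDeg G v + inMissing G v Finset.univ = n :=
  outDeg_add_outMissing (fun x y => G y x) v

/-- For every `η > 0` there is an `n₀` such that every digraph on `n ≥ n₀` vertices with
minimum total degree at least `(8/5 + η)n` contains the square of a Hamilton cycle. -/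
theorem statement_0 (η : ℝ) (hη : 0 < η) :
    ∃ n₀ : ℕ, ∀ n : ℕ, n₀ ≤ n → ∀ G : Fin n → Fin n → Prop, IsDigraph G →
      (∀ v, (8/5 + η) * n ≤ ((outDeg G v + inDeg G v : ℕ) : ℝ)) →
      HasPowHamCycle 2 G := by
  obtain ⟨θ, hθ0, hθη, hθ⟩ : ∃ θ : ℝ, 0 < θ ∧ θ ≤ η ∧ θ ≤ 1 / 5 :=
    ⟨min η (1 / 5), by positivity, min_le_left _ _, min_le_right _ _⟩
  obtain ⟨k, hk⟩ := exists_nat_ge (7 / θ)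
  obtain ⟨B, hB⟩ : ∃ B : ℕ, B = 10 * k + 4 + 2 * (41 * (5 * k + 4)) := ⟨_, rfl⟩
  obtain ⟨c, hc⟩ : ∃ c : ℝ, c = (θ / 28) ^ 2 / 16 := ⟨_, rfl⟩
  have hc0 : 0 < c := by rw [hc]; positivity
  obtain ⟨n₀, hn₀⟩ := exists_nat_ge (60 + 32 / θ + 4 / c ^ 2 + 8 * (B + 1) / θ)
  refine ⟨n₀, fun n hn G hG hdeg => ?_⟩
  have hnr : 60 + 32 / θ + 4 / c ^ 2 + 8 * (B + 1) / θ ≤ n := hn₀.trans (by exact_mod_cast hn)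
  have hpos1 : 0 < 32 / θ := by positivity
  have hpos2 : 0 < 4 / c ^ 2 := by positivity
  have hpos3 : 0 < 8 * ((B : ℝ) + 1) / θ := by positivity
  have hn60 : (60 : ℝ) ≤ n := by linarith
  have hnθ : 32 ≤ n * θ := (div_le_iff₀ hθ0).1 (by linarith)
  have hnB : 8 * ((B : ℝ) + 1) ≤ n * θ := (div_le_iff₀ hθ0).1 (by linarith)
  have hkθ : 7 ≤ k * θ := (div_le_iff₀ hθ0).1 hk
  have hnθ' : n * θ ≤ n * (1 / 5) := by gcongr
  have hM : ∀ v, ((outMissing G v Finset.univ + inMissing G v Finset.univ : ℕ) : ℝ) ≤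
      (2 / 5 - θ) * n := by
    intro v
    have h1 : (outDeg G v : ℝ) + outMissing G v Finset.univ = n := by
      exact_mod_cast outDeg_add_outMissing G v
    have h2 : (inDeg G v : ℝ) + inMissing G v Finset.univ = n := by
      exact_mod_cast inDeg_add_inMissing G v
    have h3 := hdeg v
    have h4 : θ * n ≤ η * n := by gcongr
    push_cast at h3 ⊢
    linarith
  obtain ⟨R, hRle, hRge, hRmiss⟩ := exists_reservoir G (p := 1 / 10) (ε := θ / 28) (by norm_num)
    (by norm_num) (by positivity) (by linarith) hM (by
      have := add_two_mul_exp_neg_lt_one (x := n) hc0 (by linarith) (by linarith)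
      rw [Fintype.card_fin, mul_div_right_comm, ← hc]
      exact this)
  rw [Fintype.card_fin] at hRle hRge
  simp only [Fintype.card_fin] at hRmiss
  obtain ⟨DR, hDR⟩ : ∃ DR, DR = ⌊1 / 10 * ((2 / 5 - θ) * n) + θ / 28 * n⌋₊ := ⟨_, rfl⟩
  obtain ⟨D, hD⟩ : ∃ D, D = ⌊(2 / 5 - θ) * n⌋₊ := ⟨_, rfl⟩
  obtain ⟨E, hE⟩ : ∃ E, E = ⌊n * θ / 16⌋₊ := ⟨_, rfl⟩
  obtain ⟨g, hg⟩ : ∃ g, g = ⌊(n : ℝ) / 20⌋₊ := ⟨_, rfl⟩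
  have hDle : (D : ℝ) ≤ (2 / 5 - θ) * n := hD ▸ Nat.floor_le (by nlinarith)
  have hDRle : (DR : ℝ) ≤ 1 / 10 * ((2 / 5 - θ) * n) + θ / 28 * n :=
    hDR ▸ Nat.floor_le (by nlinarith)
  have hEle : (E : ℝ) ≤ n * θ / 16 := hE ▸ Nat.floor_le (by positivity)
  have hEge : n * θ / 16 < E + 1 := hE ▸ Nat.lt_floor_add_one _
  have hgle : (g : ℝ) ≤ n / 20 := hg ▸ Nat.floor_le (by positivity)
  have hgge : (n : ℝ) / 20 < g + 1 := hg ▸ Nat.lt_floor_add_one _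
  obtain ⟨L, a, b, hL, hmem, htake, hpath⟩ := exists_spanning_sqCycle (G := G) (D := D) (DR := DR)
    (E := E) (k := k) (g := g) (J := 41) (R := R) hG (fun v => hD ▸ Nat.le_floor (hM v))
    (fun v => hDR ▸ Nat.le_floor (hRmiss v)) (by
      have h1 : (n : ℝ) * θ / 32 ≤ E := by linarith
      have h2 : (k : ℝ) * (n * θ / 32) ≤ k * E := by gcongr
      have h3 : (n : ℝ) * 7 ≤ n * (k * θ) := by gcongr
      have h4 : (2 : ℝ) * DR ≤ k * E := by linarith
      exact_mod_cast h4) (by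
      have h1 : (1 : ℝ) < g := by linarith
      have h2 : 1 < g := by exact_mod_cast h1
      omega) (by
      rw [Fintype.card_fin]
      have h1 : (n : ℝ) < 41 * g := by linarith
      exact_mod_cast h1) (by
      rw [Fintype.card_fin]
      have h1 : (g : ℝ) + R.card + 2 * D + 3 ≤ n := by linarith
      exact_mod_cast h1) (by
      have h1 : 5 * (DR : ℝ) + 2 * E + B < 2 * R.card := by linarith
      have h2 : 5 * DR + 2 * E + B < 2 * R.card := by exact_mod_cast h1
      omega)
  exact hasPowHamCycle_two_of_sqCycle hL hmem htake hpath

end Paper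
end

section
/- There exists a constant K > 1 such that for every r ∈ ℕ the following holds: for all sufficiently large n, every n-vertex oriented graph G with minimum semi-degree δ⁰(G) ≥ (1/2 − 1/K^r)n contains a copy of D_r. Equivalently, κ⁰(D_r) < 1/2 − 1/K^r for every r ∈ ℕ. -/
namespace Paper

/-- The tournament `D_r` on `3r` vertices: three blocks of `r` vertices (block of `v` is
`v / r`, position is `v % r`), with all edges from block `0` to block `1`, block `1` to
block `2`, and block `2` to block `0`, and a transitive tournament inside each block. -/
def Dgraph (r : ℕ) : Fin (3*r) → Fin (3*r) → Prop :=
  fun u v =>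
    ((v : ℕ) / r = ((u : ℕ) / r + 1) % 3) ∨
    ((u : ℕ) / r = (v : ℕ) / r ∧ (u : ℕ) % r < (v : ℕ) % r)

section Helpers

open Finset Classical

variable {V : Type*}

/-- `S` is spanned by a transitive tournament of `G`. -/
def IsTransSet (G : V → V → Prop) (S : Finset V) : Prop :=
  ∃ l : List V, l.Pairwise G ∧ l.Nodup ∧ l.toFinset = S

theorem IsTransSet.subset {G : V → V → Prop} {S T : Finset V} (hS : IsTransSet G S)
    (hTS : T ⊆ S) : IsTransSet G T := by
  obtain ⟨l, hl, hnd, rfl⟩ := hS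
  refine ⟨l.filter (· ∈ T), hl.filter _, hnd.filter _, ?_⟩
  ext x
  simp only [List.mem_toFinset, List.mem_filter, decide_eq_true_eq]
  exact ⟨fun h => h.2, fun h => ⟨List.mem_toFinset.1 (hTS h), h⟩⟩

theorem IsTransSet.insert {G : V → V → Prop} {S : Finset V} {v : V} (hS : IsTransSet G S)
    (hv : v ∉ S) (hG : ∀ w ∈ S, G v w) : IsTransSet G (insert v S) := by
  obtain ⟨l, hl, hnd, rfl⟩ := hS
  simp only [List.mem_toFinset] at hv hG
  exact ⟨v :: l, List.pairwise_cons.2 ⟨hG, hl⟩, List.nodup_cons.2 ⟨hv, hnd⟩, by simp⟩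

theorem sum_card_out_eq_sum_card_in (G : V → V → Prop) (U : Finset V) :
    ∑ v ∈ U, #{w ∈ U | G v w} = ∑ v ∈ U, #{w ∈ U | G w v} :=
  sum_card_bipartiteAbove_eq_sum_card_bipartiteBelow G

theorem two_mul_sum_card_out_le {G : V → V → Prop} (hG : ∀ u v, G u v → ¬ G v u)
    (U : Finset V) : 2 * ∑ v ∈ U, #{w ∈ U | G v w} ≤ #U * #U := by
  have h : ∀ v ∈ U, #{w ∈ U | G v w} + #{w ∈ U | G w v} ≤ #U := by
    intro v _
    rw [← card_union_of_disjoint]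
    · exact card_le_card (union_subset (filter_subset _ _) (filter_subset _ _))
    · exact disjoint_filter.2 fun w _ h => hG _ _ h
  have := sum_le_card_nsmul U _ _ h
  rw [sum_add_distrib, ← sum_card_out_eq_sum_card_in G U, smul_eq_mul] at this
  omega

/-- Every set in which each vertex has few non-neighbours has a vertex of large out-degree. -/
theorem exists_large_out {G : V → V → Prop} {U : Finset V} {d : ℕ} (hne : U.Nonempty)
    (hd : ∀ v ∈ U, #{w ∈ U | ¬ G v w ∧ ¬ G w v} ≤ d) (hU : 2 * d ≤ #U) :
    ∃ v ∈ U, #U ≤ 4 * #{w ∈ U | G v w} := by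
  by_contra! hcon
  have h : ∀ v ∈ U, #U ≤ #{w ∈ U | G v w} + #{w ∈ U | G w v} + d := by
    intro v hv
    refine le_trans ?_ (Nat.add_le_add_left (hd v hv) _)
    refine le_trans (card_le_card (t := ({w ∈ U | G v w} ∪ {w ∈ U | G w v}) ∪
      {w ∈ U | ¬ G v w ∧ ¬ G w v}) ?_) ((card_union_le _ _).trans
        (Nat.add_le_add_right (card_union_le _ _) _))
    intro w hw
    simp only [mem_union, mem_filter]
    tauto
  have h1 := card_nsmul_le_sum U _ _ h
  rw [sum_add_distrib, sum_add_distrib, ← sum_card_out_eq_sum_card_in G U, smul_eq_mul,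
    sum_const, smul_eq_mul] at h1
  have h2 := sum_lt_sum_of_nonempty hne hcon
  rw [← mul_sum, sum_const, smul_eq_mul] at h2
  nlinarith [Nat.mul_le_mul_left #U hU]

theorem exists_isTransSet {G : V → V → Prop} (hG : ∀ u v, G u v → ¬ G v u) {d : ℕ}
    (hd0 : 0 < d) (s : ℕ) : ∀ U : Finset V,
      (∀ v ∈ U, #{w ∈ U | ¬ G v w ∧ ¬ G w v} ≤ d) → 4 ^ s * d ≤ #U →
      ∃ S ⊆ U, #S = s ∧ IsTransSet G S := by
  induction s with
  | zero => exact fun U _ _ => ⟨∅, empty_subset _, rfl, [], by simp⟩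
  | succ s ih =>
    intro U hd hU
    have hpos : 0 < 4 ^ s * d := by positivity
    have hle : d ≤ 4 ^ s * d := Nat.le_mul_of_pos_left _ (by positivity)
    rw [pow_succ] at hU
    obtain ⟨v, hv, hout⟩ := exists_large_out (card_pos.1 (by nlinarith)) hd (by nlinarith)
    obtain ⟨S, hS, hcard, hT⟩ := ih {w ∈ U | G v w}
      (fun w hw => (card_le_card (filter_subset_filter _ (filter_subset _ _))).trans
        (hd w (filter_subset _ _ hw))) (by nlinarith)
    have hvS : v ∉ S := fun h => by
      have := (mem_filter.1 (hS h)).2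
      exact hG _ _ this this
    exact ⟨insert v S, insert_subset hv (hS.trans (filter_subset _ _)),
      by rw [card_insert_of_notMem hvS, hcard],
      hT.insert hvS fun w hw => (mem_filter.1 (hS hw)).2⟩

/-- A function bounded by `Q` with average at least `Q / k` is often at least `Q / (2k)`. -/
theorem card_le_mul_card_large [Fintype V] (f : V → ℕ) {Q k : ℕ} (hQ : 0 < Q)
    (hf : ∀ v, f v ≤ Q) (hsum : Fintype.card V * Q ≤ k * ∑ v, f v) :
    Fintype.card V ≤ 2 * k * #{v | Q ≤ 2 * k * f v} := by
  have h1 : ∑ v with Q ≤ 2 * k * f v, f v ≤ #{v | Q ≤ 2 * k * f v} * Q :=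
    sum_le_card_nsmul _ _ _ fun v _ => hf v
  have h2 : ∑ v with ¬ Q ≤ 2 * k * f v, 2 * k * f v ≤ Fintype.card V * Q := by
    refine (sum_le_card_nsmul _ _ Q fun v hv => ?_).trans
      (Nat.mul_le_mul_right _ (card_le_univ _))
    exact (not_le.1 (mem_filter.1 hv).2).le
  rw [← mul_sum] at h2
  rw [← sum_filter_add_sum_filter_not univ (fun v => Q ≤ 2 * k * f v) f] at hsum
  refine Nat.le_of_mul_le_mul_right ?_ hQ
  nlinarith [Nat.mul_le_mul_left (2 * k) h1]

/-- Pigeonhole: a map into the subsets of a small set has a large fibre. -/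
theorem exists_large_fiber (X : Finset V) {β : Type*} (g : V → Finset β) (S : Finset β)
    (hg : ∀ x ∈ X, g x ⊆ S) (hX : X.Nonempty) :
    ∃ x ∈ X, #X ≤ 2 ^ #S * #{y ∈ X | g y = g x} := by
  by_contra! hcon
  have hcard := card_eq_sum_card_image g X
  have hlt : ∀ T ∈ X.image g, 2 ^ #S * #{y ∈ X | g y = T} < #X := by
    intro T hT
    obtain ⟨x, hx, rfl⟩ := mem_image.1 hT
    exact hcon x hx
  have h1 := sum_lt_sum_of_nonempty (hX.image g) hlt
  rw [← mul_sum, ← hcard, sum_const, smul_eq_mul] at h1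
  have h2 : #(X.image g) ≤ 2 ^ #S := by
    rw [← card_powerset]
    exact card_le_card (image_subset_iff.2 fun x hx => mem_powerset.2 (hg x hx))
  exact absurd (h1.trans_le (Nat.mul_le_mul_right _ h2)) (lt_irrefl _)

section Fintype

variable [Fintype V] {G : V → V → Prop} {d : ℕ}

theorem card_nonneighbors_le (hG : ∀ u v, G u v → ¬ G v u)
    (hout : ∀ v, Fintype.card V ≤ 2 * #{w | G v w} + d)
    (hin : ∀ v, Fintype.card V ≤ 2 * #{w | G w v} + d) (v : V) :
    #{w | ¬ G v w ∧ ¬ G w v} ≤ d := by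
  have h : #{w | G v w} + #{w | G w v} + #{w | ¬ G v w ∧ ¬ G w v} ≤ Fintype.card V := by
    rw [← card_union_of_disjoint (disjoint_filter.2 fun w _ h => hG _ _ h),
      ← card_union_of_disjoint]
    · exact card_le_univ _
    · rw [← filter_or]
      exact disjoint_filter.2 fun w _ => by tauto
  have h1 := hout v
  have h2 := hin v
  omega

/-- Every vertex lies in quadratically many directed triangles. -/
theorem sq_card_le_triangles (hG : ∀ u v, G u v → ¬ G v u)
    (hout : ∀ v, Fintype.card V ≤ 2 * #{w | G v w} + d)
    (hin : ∀ v, Fintype.card V ≤ 2 * #{w | G w v} + d) (hd : 11 * d ≤ Fintype.card V)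
    (a : V) : Fintype.card V * Fintype.card V ≤
      32 * ∑ b, #{w | G a b ∧ G b w ∧ G w a} := by
  set n := Fintype.card V with hn
  set P : Finset V := {b | G a b} with hP
  have hsub : ∑ b ∈ P, #{w | G b w ∧ G w a} ≤ ∑ b, #{w | G a b ∧ G b w ∧ G w a} := by
    refine le_trans (le_of_eq ?_) (sum_le_sum_of_subset (subset_univ P))
    refine sum_congr rfl fun b hb => ?_
    have : G a b := (mem_filter.1 hb).2
    simp [this]
  have hb : ∀ b ∈ P, n ≤ 2 * (#{w ∈ P | G b w} + #{w | G b w ∧ G w a} + d) + d := by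
    intro b _
    have hnon := card_nonneighbors_le hG hout hin a
    refine (hout b).trans ?_
    gcongr
    refine le_trans ?_ (Nat.add_le_add_left hnon _)
    refine le_trans (card_le_card (t := ({w ∈ P | G b w} ∪
      ({w | G b w ∧ G w a} : Finset V)) ∪
        ({w | ¬ G a w ∧ ¬ G w a} : Finset V)) ?_)
      ((card_union_le _ _).trans (Nat.add_le_add_right (card_union_le _ _) _))
    intro w hw
    simp only [hP, mem_union, mem_filter, mem_univ, true_and] at hw ⊢
    tauto
  have h1 := card_nsmul_le_sum P _ _ hb
  rw [sum_add_distrib, ← mul_sum, sum_add_distrib, sum_add_distrib, sum_const, smul_eq_mul,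
    smul_eq_mul] at h1
  have h2 := two_mul_sum_card_out_le hG P
  have hp1 : n ≤ 2 * #P + d := hout a
  have hp2 : 2 * #P ≤ n + d := by
    have h := hin a
    have : #P + #{w | G w a} ≤ n := by
      rw [hP, ← card_union_of_disjoint (disjoint_filter.2 fun w _ h => hG _ _ h)]
      exact card_le_univ _
    omega
  generalize ∑ b ∈ P, #{w ∈ P | G b w} = x at h1 h2
  generalize ∑ b ∈ P, #{w | G b w ∧ G w a} = t at h1 hsub
  refine le_trans ?_ (Nat.mul_le_mul_left 32 hsub)
  generalize #P = p at *
  clear_value n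
  zify at *
  have h3 : (p : ℤ) * (n - 3 * d - p) ≤ 2 * t := by nlinarith
  have h4 : (p : ℤ) * (n - 7 * d) ≤ 4 * t := by nlinarith
  have h5 : ((n : ℤ) - d) * (n - 7 * d) ≤ 8 * t := by nlinarith
  nlinarith

/-- The edges `a → b` of `G` lying in at least `|V| / 64` directed triangles. -/
def RichEdge (G : V → V → Prop) (a b : V) : Prop :=
  G a b ∧ Fintype.card V ≤ 64 * #{w | G b w ∧ G w a}

theorem card_le_richEdge_out (hG : ∀ u v, G u v → ¬ G v u)
    (hout : ∀ v, Fintype.card V ≤ 2 * #{w | G v w} + d)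
    (hin : ∀ v, Fintype.card V ≤ 2 * #{w | G w v} + d) (hd : 11 * d ≤ Fintype.card V)
    (a : V) : Fintype.card V ≤ 64 * #{b | RichEdge G a b} := by
  have hpos : 0 < Fintype.card V := Fintype.card_pos_iff.2 ⟨a⟩
  refine (card_le_mul_card_large _ hpos (fun b => card_le_univ _)
    (sq_card_le_triangles hG hout hin hd a)).trans ?_
  refine Nat.mul_le_mul_left _ (card_le_card fun b hb => ?_)
  simp only [mem_filter, mem_univ, true_and] at hb ⊢
  by_cases hab : G a b
  · exact ⟨hab, by simpa [hab] using hb⟩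
  · simp [hab] at hb
    exact absurd hb hpos.ne'

theorem exists_rich_pair (hG : ∀ u v, G u v → ¬ G v u)
    (hout : ∀ v, Fintype.card V ≤ 2 * #{w | G v w} + d)
    (hin : ∀ v, Fintype.card V ≤ 2 * #{w | G w v} + d) (hd0 : 0 < d) {s : ℕ} (hs : 0 < s)
    (hd : 2 ^ (7 + 128 * s + 2 * s + 128 * s) * d ≤ Fintype.card V) :
    ∃ A B : Finset V, s ≤ #A ∧ #A ≤ 128 * s ∧ #B = s ∧ IsTransSet G A ∧ IsTransSet G B ∧
      ∀ a ∈ A, ∀ b ∈ B, RichEdge G a b := by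
  have hnon := card_nonneighbors_le hG hout hin
  set n := Fintype.card V with hn
  have hpow : ∀ k ≤ 7 + 128 * s + 2 * s + 128 * s, 2 ^ k * d ≤ n := fun k hk =>
    (Nat.mul_le_mul_right _ (Nat.pow_le_pow_right two_pos hk)).trans hd
  obtain ⟨A₀, -, hA₀, hA₀T⟩ := exists_isTransSet hG hd0 (128 * s) univ (fun v _ => hnon v) (by
    rw [show (4 : ℕ) = 2 ^ 2 from rfl, ← pow_mul, card_univ]
    exact hpow _ (by omega))
  have hd11 : 11 * d ≤ n := (Nat.mul_le_mul_right d (by norm_num)).trans (hpow 4 (by omega))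
  set g : V → Finset V := fun b => {a ∈ A₀ | RichEdge G a b} with hg
  have hsum : n * #A₀ ≤ 64 * ∑ b, #(g b) := by
    have h : ∑ a ∈ A₀, #{b | RichEdge G a b} = ∑ b, #(g b) :=
      sum_card_bipartiteAbove_eq_sum_card_bipartiteBelow (RichEdge G)
    rw [← h, mul_sum, mul_comm, ← smul_eq_mul]
    exact card_nsmul_le_sum _ _ _ fun a _ => card_le_richEdge_out hG hout hin hd11 a
  have hX := card_le_mul_card_large (fun b => #(g b)) (by omega)
    (fun b => card_le_card (filter_subset _ A₀)) hsum
  set X : Finset V := {b | #A₀ ≤ 2 * 64 * #(g b)}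
  have hn0 : 0 < n := lt_of_lt_of_le (by positivity) hd
  obtain ⟨x, hx, hfib⟩ := exists_large_fiber X g A₀ (fun b _ => filter_subset _ _)
    (card_pos.1 (by omega))
  have hx' : #A₀ ≤ 2 * 64 * #(g x) := (mem_filter.1 hx).2
  obtain ⟨B, hB, hBs, hBT⟩ := exists_isTransSet hG hd0 s {y ∈ X | g y = g x}
    (fun v _ => (card_le_card (filter_subset_filter _ (subset_univ _))).trans (hnon v)) (by
      have h1 := hpow (7 + 128 * s + 2 * s) (by omega)
      rw [pow_add, pow_add, pow_mul 2 2 s, ← hA₀] at h1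
      refine le_of_mul_le_mul_left (a := 2 ^ 7 * 2 ^ #A₀) ?_ (by positivity)
      norm_num at h1 hX ⊢
      nlinarith)
  refine ⟨g x, B, by omega, hA₀ ▸ card_le_card (filter_subset _ _), hBs,
    hA₀T.subset (filter_subset _ _), hBT, fun a ha b hb => ?_⟩
  rw [← (mem_filter.1 (hB hb)).2] at ha
  exact (mem_filter.1 ha).2

theorem exists_cyclic_triple (hG : ∀ u v, G u v → ¬ G v u)
    (hout : ∀ v, Fintype.card V ≤ 2 * #{w | G v w} + d)
    (hin : ∀ v, Fintype.card V ≤ 2 * #{w | G w v} + d) (hd0 : 0 < d) {r : ℕ} (hr : 0 < r)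
    (hd : 2 ^ (40000 * r) * d ≤ Fintype.card V) :
    ∃ A B C : Finset V, (#A = r ∧ #B = r ∧ #C = r) ∧
      (IsTransSet G A ∧ IsTransSet G B ∧ IsTransSet G C) ∧
      (∀ a ∈ A, ∀ b ∈ B, G a b) ∧ (∀ b ∈ B, ∀ c ∈ C, G b c) ∧ ∀ c ∈ C, ∀ a ∈ A, G c a := by
  have hnon := card_nonneighbors_le hG hout hin
  have hpow : ∀ k ≤ 40000 * r, 2 ^ k * d ≤ Fintype.card V := fun k hk =>
    (Nat.mul_le_mul_right _ (Nat.pow_le_pow_right two_pos hk)).trans hd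
  obtain ⟨A, B, hA, hA', hB, hAT, hBT, hAB⟩ := exists_rich_pair hG hout hin hd0
    (s := 128 * r) (by omega) (hpow _ (by omega))
  set n := Fintype.card V with hn
  set fA : V → Finset V := fun w => {a ∈ A | G w a} with hfA
  set fB : V → Finset V := fun w => {b ∈ B | G b w} with hfB
  have hfAle : ∀ w, #(fA w) ≤ #A := fun w => card_le_card (filter_subset _ _)
  have hfBle : ∀ w, #(fB w) ≤ #B := fun w => card_le_card (filter_subset _ _)
  have hsum : n * (#A * #B) ≤ 64 * ∑ w, #(fA w) * #(fB w) := by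
    have h : ∑ p ∈ A ×ˢ B, #{w | G p.2 w ∧ G w p.1} = ∑ w, #(fA w) * #(fB w) := by
      refine (sum_card_bipartiteAbove_eq_sum_card_bipartiteBelow
        (fun (p : V × V) w => G p.2 w ∧ G w p.1)).trans ?_
      refine sum_congr rfl fun w _ => ?_
      rw [← card_product]
      congr 1
      ext p
      simp only [bipartiteBelow, hfA, hfB, mem_filter, mem_product]
      tauto
    rw [← h, mul_sum, mul_comm, ← card_product, ← smul_eq_mul]
    refine card_nsmul_le_sum _ _ _ fun p hp => ?_
    exact (hAB _ (mem_product.1 hp).1 _ (mem_product.1 hp).2).2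
  have hX := card_le_mul_card_large (fun w => #(fA w) * #(fB w))
    (Nat.mul_pos (by omega) (by omega))
    (fun w => Nat.mul_le_mul (hfAle w) (hfBle w)) hsum
  set X : Finset V := {w | #A * #B ≤ 2 * 64 * (#(fA w) * #(fB w))} with hXdef
  have hn0 : 0 < n := lt_of_lt_of_le (by positivity) hd
  obtain ⟨x, hx, hfib⟩ := exists_large_fiber X (fun w => (fA w).disjSum (fB w)) (A.disjSum B)
    (fun w _ => disjSum_mono (filter_subset _ _) (filter_subset _ _)) (card_pos.1 (by omega))
  have hx' : #A * #B ≤ 2 * 64 * (#(fA x) * #(fB x)) := (mem_filter.1 hx).2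
  have hAx : r ≤ #(fA x) := by
    by_contra! h
    have := Nat.mul_le_mul_left (#(fA x)) (hfBle x)
    have hBpos : 0 < #B := by omega
    have : #A ≤ 2 * 64 * #(fA x) := Nat.le_of_mul_le_mul_right (by nlinarith) hBpos
    omega
  have hBx : r ≤ #(fB x) := by
    by_contra! h
    have := Nat.mul_le_mul_right (#(fB x)) (hfAle x)
    have hApos : 0 < #A := by omega
    have : #B ≤ 2 * 64 * #(fB x) := Nat.le_of_mul_le_mul_left (by nlinarith) hApos
    omega
  obtain ⟨C, hC, hCr, hCT⟩ := exists_isTransSet hG hd0 r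
    {y ∈ X | (fA y).disjSum (fB y) = (fA x).disjSum (fB x)}
    (fun v _ => (card_le_card (filter_subset_filter _ (subset_univ _))).trans (hnon v)) (by
      have h1 := hpow (7 + #(A.disjSum B) + 2 * r) (by rw [card_disjSum]; omega)
      rw [pow_add, pow_add, pow_mul 2 2 r] at h1
      refine le_of_mul_le_mul_left (a := 2 ^ 7 * 2 ^ #(A.disjSum B)) ?_ (by positivity)
      norm_num at h1 hX hfib ⊢
      nlinarith)
  obtain ⟨A', hA'sub, hA'r⟩ := exists_subset_card_eq hAx
  obtain ⟨B', hB'sub, hB'r⟩ := exists_subset_card_eq hBx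
  have hCeq : ∀ c ∈ C, fA c = fA x ∧ fB c = fB x := fun c hc => by
    have h := (mem_filter.1 (hC hc)).2
    refine ⟨?_, ?_⟩
    · ext a; simpa using congrArg (Sum.inl a ∈ ·) h
    · ext b; simpa using congrArg (Sum.inr b ∈ ·) h
  refine ⟨A', B', C, ⟨hA'r, hB'r, hCr⟩,
    ⟨hAT.subset (hA'sub.trans (filter_subset _ _)),
      hBT.subset (hB'sub.trans (filter_subset _ _)), hCT⟩, ?_, ?_, ?_⟩
  · exact fun a ha b hb => (hAB a (filter_subset _ _ (hA'sub ha)) b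
      (filter_subset _ _ (hB'sub hb))).1
  · intro b hb c hc
    have h := hB'sub hb
    rw [← (hCeq c hc).2] at h
    exact (mem_filter.1 h).2
  · intro c hc a ha
    have h := hA'sub ha
    rw [← (hCeq c hc).1] at h
    exact (mem_filter.1 h).2

end Fintype

theorem IsTransSet.exists_enum {G : V → V → Prop} {S : Finset V} (hS : IsTransSet G S)
    {r : ℕ} (hr : #S = r) :
    ∃ f : Fin r → V, (∀ i, f i ∈ S) ∧ ∀ i j, i < j → G (f i) (f j) := by
  obtain ⟨l, hl, hnd, rfl⟩ := hS
  rw [List.toFinset_card_of_nodup hnd] at hr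
  subst hr
  exact ⟨l.get, fun i => List.mem_toFinset.2 (l.get_mem i),
    fun i j hij => List.pairwise_iff_get.1 hl i j hij⟩

/-- Any two distinct vertices of `D_r` are joined by an edge. -/
theorem Dgraph_total {r : ℕ} {i j : Fin (3 * r)} (hij : i ≠ j) :
    Dgraph r i j ∨ Dgraph r j i := by
  have hi : (i : ℕ) / r < 3 := Nat.div_lt_of_lt_mul (by have := i.2; omega)
  have hj : (j : ℕ) / r < 3 := Nat.div_lt_of_lt_mul (by have := j.2; omega)
  have hi' := Nat.div_add_mod (i : ℕ) r
  have hj' := Nat.div_add_mod (j : ℕ) r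
  have hne : (i : ℕ) ≠ j := fun h => hij (Fin.ext h)
  unfold Dgraph
  by_cases h : (i : ℕ) / r = (j : ℕ) / r
  · have : (i : ℕ) % r ≠ (j : ℕ) % r := fun h' => hne (by rw [← hi', ← hj', h, h'])
    omega
  · generalize (i : ℕ) / r = a at *
    generalize (j : ℕ) / r = b at *
    interval_cases a <;> interval_cases b <;> simp_all

theorem exists_Dgraph_embedding {G : V → V → Prop} (hG : ∀ u v, G u v → ¬ G v u) {r : ℕ}
    (hr : 0 < r) {A B C : Finset V} (hA : #A = r) (hB : #B = r) (hC : #C = r) (hAT : IsTransSet G A)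
    (hBT : IsTransSet G B) (hCT : IsTransSet G C) (hAB : ∀ a ∈ A, ∀ b ∈ B, G a b)
    (hBC : ∀ b ∈ B, ∀ c ∈ C, G b c) (hCA : ∀ c ∈ C, ∀ a ∈ A, G c a) :
    ∃ f : Fin (3 * r) → V, Function.Injective f ∧ ∀ i j, Dgraph r i j → G (f i) (f j) := by
  obtain ⟨fA, hfA, hfA'⟩ := hAT.exists_enum hA
  obtain ⟨fB, hfB, hfB'⟩ := hBT.exists_enum hB
  obtain ⟨fC, hfC, hfC'⟩ := hCT.exists_enum hC
  set F : ℕ → Fin r → V := fun k => if k = 0 then fA else if k = 1 then fB else fC with hF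
  have hedge : ∀ i j : Fin (3 * r), Dgraph r i j →
      G (F (i / r) ⟨i % r, Nat.mod_lt _ hr⟩) (F (j / r) ⟨j % r, Nat.mod_lt _ hr⟩) := by
    intro i j hij
    have hi : (i : ℕ) / r < 3 := Nat.div_lt_of_lt_mul (by have := i.2; omega)
    have hj : (j : ℕ) / r < 3 := Nat.div_lt_of_lt_mul (by have := j.2; omega)
    rcases hij with h | ⟨h, hlt⟩
    · rw [h]
      generalize (i : ℕ) / r = k at hi
      interval_cases k
      · exact hAB _ (hfA _) _ (hfB _)
      · exact hBC _ (hfB _) _ (hfC _)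
      · exact hCA _ (hfC _) _ (hfA _)
    · rw [h]
      generalize (j : ℕ) / r = k at hj
      interval_cases k
      · exact hfA' _ _ hlt
      · exact hfB' _ _ hlt
      · exact hfC' _ _ hlt
  refine ⟨fun i => F (i / r) ⟨i % r, Nat.mod_lt _ hr⟩, fun i j hfij => ?_, hedge⟩
  by_contra hne
  have hirr : ∀ v, ¬ G v v := fun v h => hG _ _ h h
  rcases Dgraph_total hne with h | h
  · exact hirr _ ((congrArg (G · _) hfij) ▸ hedge i j h)
  · exact hirr _ ((congrArg (G _ ·) hfij) ▸ hedge j i h)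

/-- A semi-degree of at least `(1/2 - ε)n` as an inequality between natural numbers. -/
theorem le_two_mul_add_floor {ε : ℝ} (hε : 0 ≤ ε) {n m : ℕ} (h : (1 / 2 - ε) * n ≤ m) :
    n ≤ 2 * m + ⌊2 * ε * n⌋₊ := by
  rw [← Nat.sub_le_iff_le_add']
  refine Nat.le_floor ?_
  rcases le_total (2 * m) n with hle | hle
  · push_cast [Nat.cast_sub hle]
    linarith
  · rw [Nat.sub_eq_zero_of_le hle]
    push_cast
    positivity

theorem two_pow_mul_floor_le (M : ℕ) {r : ℕ} (hr : 1 ≤ r) (n : ℕ) :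
    2 ^ (M * r) * ⌊2 * (1 / ((2 : ℝ) ^ (M + 1)) ^ r) * n⌋₊ ≤ n := by
  have hfl : (⌊2 * (1 / ((2 : ℝ) ^ (M + 1)) ^ r) * n⌋₊ : ℝ) ≤
      2 * (1 / ((2 : ℝ) ^ (M + 1)) ^ r) * n := Nat.floor_le (by positivity)
  have h2 : (2 : ℝ) ≤ 2 ^ r := by
    simpa using pow_le_pow_right₀ (one_le_two : (1 : ℝ) ≤ 2) hr
  have hcast : ((2 ^ (M * r) * ⌊2 * (1 / ((2 : ℝ) ^ (M + 1)) ^ r) * n⌋₊ : ℕ) : ℝ) ≤ n := by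
    push_cast
    calc _ ≤ (2 : ℝ) ^ (M * r) * (2 * (1 / ((2 : ℝ) ^ (M + 1)) ^ r) * n) := by gcongr
      _ = 2 / 2 ^ r * n := by
        rw [← pow_mul, add_mul, one_mul, pow_add]
        field_simp
      _ ≤ 1 * n := by
        gcongr
        exact (div_le_one (by positivity)).2 h2
      _ = n := one_mul _
  exact_mod_cast hcast

end Helpers

/-- There is a constant `K > 1` such that for every `r ≥ 1`, every sufficiently large
`n`-vertex oriented graph with minimum semi-degree at least `(1/2 - 1/K^r)n` contains a
copy of `D_r` (equivalently, `κ⁰(D_r) < 1/2 - 1/K^r`). -/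
theorem statement_19 :
    ∃ K : ℝ, 1 < K ∧ ∀ r : ℕ, 1 ≤ r →
      ∃ n₀ : ℕ, ∀ n : ℕ, n₀ ≤ n → ∀ G : Fin n → Fin n → Prop, IsOriented G →
        (∀ v, (1/2 - 1/K^r) * n ≤ ((min (outDeg G v) (inDeg G v) : ℕ) : ℝ)) →
        ∃ f : Fin (3*r) → Fin n, Function.Injective f ∧
          ∀ i j, Dgraph r i j → G (f i) (f j) := by
  refine ⟨2 ^ (40000 + 1), one_lt_pow₀ one_lt_two (Nat.succ_ne_zero _), fun r hr => ⟨1, ?_⟩⟩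
  generalize hM : 40000 = M
  intro n hn G hG hdeg
  classical
  have hε : (0 : ℝ) ≤ 1 / ((2 : ℝ) ^ (M + 1)) ^ r := by positivity
  set d := ⌊2 * (1 / ((2 : ℝ) ^ (M + 1)) ^ r) * n⌋₊ with hd
  have hout : ∀ v, Fintype.card (Fin n) ≤ 2 * (Finset.univ.filter (G v ·)).card + d := by
    intro v
    have h := le_two_mul_add_floor hε ((hdeg v).trans (Nat.cast_le.2 (min_le_left _ _)))
    rw [outDeg, Set.ncard_eq_toFinset_card', Set.toFinset_ofPred] at h
    rwa [Fintype.card_fin]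
  have hin : ∀ v, Fintype.card (Fin n) ≤ 2 * (Finset.univ.filter (G · v)).card + d := by
    intro v
    have h := le_two_mul_add_floor hε ((hdeg v).trans (Nat.cast_le.2 (min_le_right _ _)))
    rw [inDeg, Set.ncard_eq_toFinset_card', Set.toFinset_ofPred] at h
    rwa [Fintype.card_fin]
  have hd0 : 0 < d := by
    refine lt_of_lt_of_le (Finset.card_pos.2 ⟨⟨0, hn⟩, ?_⟩)
      (card_nonneighbors_le hG (by convert hout) (by convert hin) ⟨0, hn⟩)
    have : ¬ G ⟨0, hn⟩ ⟨0, hn⟩ := fun h => hG _ _ h h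
    simpa using this
  obtain ⟨A, B, C, ⟨hA, hB, hC⟩, ⟨hAT, hBT, hCT⟩, hAB, hBC, hCA⟩ :=
    exists_cyclic_triple hG (by convert hout) (by convert hin) hd0 hr (by
      rw [hM, Fintype.card_fin]
      exact two_pow_mul_floor_le M hr n)
  exact exists_Dgraph_embedding hG hr hA hB hC hAT hBT hCT hAB hBC hCA

end Paper
end
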